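/- For complex ν with Re ν > -1: ∫_{-1}^1 [P_ν(x)]² P_ν(-x) (1-x²)^{(ν-1)/2} dx = (1/π) (cos(νπ/2)/2^ν)³ [Γ((1+ν)/2)/Γ(1+ν/2)]⁴. -/

import Mathlib

open Real MeasureTheory intervalIntegral Complex

/-- Complete elliptic integral of the first kind. -/
noncomputable def ellipticK (k : ℝ) : ℝ :=
  ∫ θ in (0:ℝ)..(π/2), (1 - k ^ 2 * Real.sin θ ^ 2) ^ (-(1/2 : ℝ))

/-- Complete elliptic integral of the second kind. -/
noncomputable def ellipticE (k : ℝ) : ℝ :=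
  ∫ θ in (0:ℝ)..(π/2), (1 - k ^ 2 * Real.sin θ ^ 2) ^ ((1/2 : ℝ))

/-- Legendre function of the first kind of degree ν : P_ν(1-2z) = ₂F₁(-ν, ν+1; 1; z). -/
noncomputable def legendreP (ν : ℂ) (x : ℂ) : ℂ :=
  ordinaryHypergeometric (-ν) (ν + 1) 1 ((1 - x) / 2)

open Set

lemma li_subst {s t : Set ℝ} (f h f' : ℝ → ℝ) (hs : MeasurableSet s)
    (hd : ∀ x ∈ s, HasDerivAt f (f' x) x)
    (hf : ∀ x ∈ s, f x ∈ t) (hh : ∀ y ∈ t, h y ∈ s)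
    (hl : ∀ x ∈ s, h (f x) = x) (hr : ∀ y ∈ t, f (h y) = y) (g : ℝ → ENNReal) :
    ∫⁻ x in t, g x = ∫⁻ x in s, ENNReal.ofReal |f' x| * g (f x) := by
  have img : f '' s = t := by
    ext y; constructor
    · rintro ⟨x, hx, rfl⟩; exact hf x hx
    · intro hy; exact ⟨h y, hh y hy, hr y hy⟩
  rw [← img]
  refine lintegral_image_eq_lintegral_abs_deriv_mul hs (fun x hx => (hd x hx).hasDerivWithinAt) ?_ g
  intro x hx y hy hxy
  rw [← hl x hx, ← hl y hy, hxy]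

lemma li_beta {α β : ℝ} (ha : 0 < α) (hb : 0 < β) :
    ∫⁻ x in Ioo (0:ℝ) 1, ENNReal.ofReal (x ^ (α - 1) * (1 - x) ^ (β - 1))
      = ENNReal.ofReal (Real.Gamma α * Real.Gamma β / Real.Gamma (α + β)) := by
  have h1 := ProbabilityTheory.lintegral_betaPDF_eq_one ha hb
  rw [ProbabilityTheory.lintegral_betaPDF] at h1
  have hB : 0 < ProbabilityTheory.beta α β := by
    unfold ProbabilityTheory.beta
    have := Real.Gamma_pos_of_pos ha; have := Real.Gamma_pos_of_pos hb
    have := Real.Gamma_pos_of_pos (add_pos ha hb); positivity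
  have h2 : ∀ x ∈ Ioo (0:ℝ) 1, ENNReal.ofReal (x ^ (α - 1) * (1 - x) ^ (β - 1))
      = ENNReal.ofReal (ProbabilityTheory.beta α β) *
        ENNReal.ofReal (1 / ProbabilityTheory.beta α β * x ^ (α - 1) * (1 - x) ^ (β - 1)) := by
    intro x hx
    rw [← ENNReal.ofReal_mul hB.le]; congr 1; field_simp
  rw [setLIntegral_congr_fun measurableSet_Ioo h2, lintegral_const_mul' _ _ ENNReal.ofReal_ne_top, h1, mul_one]
  rfl

lemma li_gamma {a r : ℝ} (ha : 0 < a) (hr : 0 < r) :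
    ∫⁻ x in Ioi (0:ℝ), ENNReal.ofReal (x ^ (a - 1) * Real.exp (-(r * x)))
      = ENNReal.ofReal (r ^ (-a) * Real.Gamma a) := by
  have h := Real.integral_rpow_mul_exp_neg_mul_Ioi ha hr
  have hg := Real.Gamma_pos_of_pos ha
  have hi : IntegrableOn (fun t : ℝ => t ^ (a - 1) * Real.exp (-(r * t))) (Ioi 0) := by
    by_contra hc
    rw [integral_undef hc] at h
    have : 0 < (1 / r) ^ a * Real.Gamma a := by positivity
    linarith
  rw [← ofReal_integral_eq_lintegral_ofReal hi, h]
  · rw [one_div, Real.inv_rpow hr.le, Real.rpow_neg hr.le]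
  · refine (ae_restrict_iff' measurableSet_Ioi).2 (Filter.Eventually.of_forall fun x hx => ?_)
    have : (0:ℝ) < x := hx
    simp only [Pi.zero_apply]; positivity

/-- beta integral on the half line -/
lemma li_beta_half {α β : ℝ} (ha : 0 < α) (hb : 0 < β) :
    ∫⁻ x in Ioi (0:ℝ), ENNReal.ofReal (x ^ (α - 1) * (1 + x) ^ (-(α + β)))
      = ENNReal.ofReal (Real.Gamma α * Real.Gamma β / Real.Gamma (α + β)) := by
  rw [← li_beta ha hb]
  rw [li_subst (s := Ioi 0) (t := Ioo 0 1) (fun x => x / (1 + x)) (fun y => y / (1 - y))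
    (fun x => 1 / (1 + x) ^ 2) measurableSet_Ioi]
  · refine setLIntegral_congr_fun measurableSet_Ioi fun x hx => ?_
    have hx : (0:ℝ) < x := hx
    have h1 : 0 < 1 + x := by linarith
    have h2 : 1 - x / (1 + x) = 1 / (1 + x) := by field_simp; ring
    rw [← ENNReal.ofReal_mul (by positivity)]; congr 1
    rw [abs_of_pos (by positivity), h2, Real.div_rpow hx.le h1.le, Real.div_rpow zero_le_one h1.le,
      Real.one_rpow, Real.rpow_sub h1, Real.rpow_sub h1, Real.rpow_neg h1.le, Real.rpow_add h1]
    simp only [Real.rpow_one]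
    have := Real.rpow_pos_of_pos h1 α; have := Real.rpow_pos_of_pos h1 β
    field_simp
  · intro x hx
    have hx : (0:ℝ) < x := hx
    have h1 : 1 + x ≠ 0 := by linarith
    exact ((hasDerivAt_id' x).div ((hasDerivAt_id' x).const_add 1) h1).congr_deriv (by simp)
  · intro x hx
    have hx : (0:ℝ) < x := hx
    exact ⟨by positivity, by rw [div_lt_one] <;> linarith⟩
  · intro y hy
    exact div_pos hy.1 (by linarith [hy.2])
  · intro x hx
    have hx : (0:ℝ) < x := hx
    have h1 : 1 + x ≠ 0 := by linarith
    field_simp; ring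
  · intro y hy
    have h1 : 1 - y ≠ 0 := by linarith [hy.2]
    field_simp; ring

lemma li_laplace {α β : Type*} [MeasurableSpace α] [MeasurableSpace β] (μ : Measure α) (ν : Measure β)
    [SFinite μ] [SFinite ν] (v : α → ENNReal) (w : β → ENNReal) (y : α → ℝ) (z : β → ℝ)
    (hv : Measurable v) (hw : Measurable w) (hy : Measurable y) (hz : Measurable z)
    (y0 : ∀ᵐ p ∂μ, 0 < y p) (z0 : ∀ᵐ p ∂ν, 0 < z p) :
    ∫⁻ η in Ioi (0:ℝ), (∫⁻ p, v p * ENNReal.ofReal (Real.exp (-(y p * η))) ∂μ) *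
        (∫⁻ p, w p * ENNReal.ofReal (Real.exp (-(z p * η))) ∂ν)
      = ∫⁻ u in Ioi (0:ℝ), (∫⁻ p, v p * ENNReal.ofReal ((y p)⁻¹ * Real.exp (-(u / y p))) ∂μ) *
        (∫⁻ p, w p * ENNReal.ofReal ((z p)⁻¹ * Real.exp (-(u / z p))) ∂ν) := by
  have e1 : ∀ η : ℝ, (∫⁻ p, v p * ENNReal.ofReal (Real.exp (-(y p * η))) ∂μ) *
        (∫⁻ p, w p * ENNReal.ofReal (Real.exp (-(z p * η))) ∂ν) =
      ∫⁻ P, (v P.1 * ENNReal.ofReal (Real.exp (-(y P.1 * η)))) *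
        (w P.2 * ENNReal.ofReal (Real.exp (-(z P.2 * η)))) ∂(μ.prod ν) := by
    intro η
    rw [← lintegral_prod_mul] <;> fun_prop
  have e2 : ∀ u : ℝ, (∫⁻ p, v p * ENNReal.ofReal ((y p)⁻¹ * Real.exp (-(u / y p))) ∂μ) *
        (∫⁻ p, w p * ENNReal.ofReal ((z p)⁻¹ * Real.exp (-(u / z p))) ∂ν) =
      ∫⁻ P, (v P.1 * ENNReal.ofReal ((y P.1)⁻¹ * Real.exp (-(u / y P.1)))) *
        (w P.2 * ENNReal.ofReal ((z P.2)⁻¹ * Real.exp (-(u / z P.2)))) ∂(μ.prod ν) := by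
    intro η
    rw [← lintegral_prod_mul] <;> fun_prop
  simp_rw [e1, e2]
  rw [lintegral_lintegral_swap (by fun_prop)]
  conv_rhs => rw [lintegral_lintegral_swap (by fun_prop)]
  have hP : ∀ᵐ P ∂(μ.prod ν), 0 < y P.1 ∧ 0 < z P.2 := by
    have a1 := (Measure.quasiMeasurePreserving_fst (μ := μ) (ν := ν)).ae y0
    have a2 := (Measure.quasiMeasurePreserving_snd (μ := μ) (ν := ν)).ae z0
    filter_upwards [a1, a2] with P h1 h2 using ⟨h1, h2⟩
  refine lintegral_congr_ae ?_
  filter_upwards [hP] with P hP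
  obtain ⟨h1, h2⟩ := hP
  set Y := y P.1
  set Z := z P.2
  have f1 : ∀ x : ℝ, v P.1 * ENNReal.ofReal (Real.exp (-(Y * x))) *
      (w P.2 * ENNReal.ofReal (Real.exp (-(Z * x)))) =
      (v P.1 * w P.2) * ENNReal.ofReal (x ^ ((1:ℝ) - 1) * Real.exp (-((Y + Z) * x))) := by
    intro x
    rw [sub_self, Real.rpow_zero, one_mul, show -((Y + Z) * x) = -(Y * x) + -(Z * x) by ring,
      Real.exp_add, ENNReal.ofReal_mul (Real.exp_pos _).le]; ring
  have f2 : ∀ x : ℝ, v P.1 * ENNReal.ofReal (Y⁻¹ * Real.exp (-(x / Y))) *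
      (w P.2 * ENNReal.ofReal (Z⁻¹ * Real.exp (-(x / Z)))) =
      (v P.1 * w P.2) * (ENNReal.ofReal (Y⁻¹ * Z⁻¹) * ENNReal.ofReal (x ^ ((1:ℝ) - 1) * Real.exp (-((Y⁻¹ + Z⁻¹) * x)))) := by
    intro x
    rw [sub_self, Real.rpow_zero, one_mul, show -((Y⁻¹ + Z⁻¹) * x) = -(x / Y) + -(x / Z) by ring,
      Real.exp_add, ENNReal.ofReal_mul (Real.exp_pos _).le,ENNReal.ofReal_mul (by positivity),ENNReal.ofReal_mul (by positivity),ENNReal.ofReal_mul (by positivity)]; ring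
  simp_rw [f1, f2]
  rw [lintegral_const_mul _ (by fun_prop), lintegral_const_mul _ (by fun_prop), lintegral_const_mul _ (by fun_prop),
    li_gamma one_pos (by positivity), li_gamma one_pos (by positivity), ← ENNReal.ofReal_mul (by positivity)]
  congr 2
  rw [Real.rpow_neg (by positivity), Real.rpow_neg (by positivity), Real.rpow_one, Real.rpow_one]
  field_simp
  ring

/-- inner kernel -/
noncomputable def KA (A η : ℝ) : ENNReal :=
  ∫⁻ s in Ioo (0:ℝ) 1, ENNReal.ofReal (s ^ (A - 1) * (1 - s) ^ (-A) * (1 + s * η) ^ (-A))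

noncomputable def TT (u : ℝ) : ENNReal := ∫⁻ x in Ioi (0:ℝ), ENNReal.ofReal (Real.exp (-x - u / x) / x)

lemma KA_eq {A η : ℝ} (h0 : 0 < A) (hη : 0 < η) :
    KA A η = ∫⁻ p, ENNReal.ofReal ((Real.Gamma A)⁻¹ * p.1 ^ (A - 1) * (1 - p.1) ^ (-A) * (p.2 ^ (A - 1) * Real.exp (-p.2))) *
        ENNReal.ofReal (Real.exp (-((p.1 * p.2) * η)))
      ∂((volume.restrict (Ioo (0:ℝ) 1)).prod (volume.restrict (Ioi (0:ℝ)))) := by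
  rw [lintegral_prod _ (by fun_prop)]
  unfold KA
  have hG := Real.Gamma_pos_of_pos h0
  refine setLIntegral_congr_fun measurableSet_Ioo fun s hs => ?_
  obtain ⟨hs0, hs1⟩ := hs
  have h1 : 0 < 1 - s := by linarith
  have e : ∀ x ∈ Ioi (0:ℝ), ENNReal.ofReal ((Real.Gamma A)⁻¹ * s ^ (A - 1) * (1 - s) ^ (-A) * (x ^ (A - 1) * Real.exp (-x))) *
        ENNReal.ofReal (Real.exp (-((s * x) * η))) =
      ENNReal.ofReal ((Real.Gamma A)⁻¹ * s ^ (A - 1) * (1 - s) ^ (-A)) *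
        ENNReal.ofReal (x ^ (A - 1) * Real.exp (-((1 + s * η) * x))) := by
    intro x hx
    have hx : 0 < x := hx
    rw [← ENNReal.ofReal_mul (by positivity), ← ENNReal.ofReal_mul (by positivity),
      show -((1 + s * η) * x) = -x + -(s * x * η) by ring, Real.exp_add]
    congr 1; ring
  simp only
  rw [setLIntegral_congr_fun measurableSet_Ioi e, lintegral_const_mul' _ _ ENNReal.ofReal_ne_top,
    li_gamma h0 (by positivity), ← ENNReal.ofReal_mul (by positivity)]
  congr 1
  field_simp

lemma inner_s {A c : ℝ} (h1 : A < 1) (hc : 0 < c) :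
    ∫⁻ s in Ioo (0:ℝ) 1, ENNReal.ofReal (s ^ (A - 2) * (1 - s) ^ (-A) * Real.exp (-(c / s)))
      = ENNReal.ofReal (Real.exp (-c) * (Real.Gamma (1 - A) * c ^ (A - 1))) := by
  rw [li_subst (s := Ioi 0) (t := Ioo 0 1) (fun x => 1 / (1 + x)) (fun y => (1 - y) / y)
    (fun x => - 1 / (1 + x) ^ 2) measurableSet_Ioi]
  · have e : ∀ x ∈ Ioi (0:ℝ), ENNReal.ofReal |(- 1 / (1 + x) ^ 2)| *
        ENNReal.ofReal ((1 / (1 + x)) ^ (A - 2) * (1 - 1 / (1 + x)) ^ (-A) * Real.exp (-(c / (1 / (1 + x))))) =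
        ENNReal.ofReal (Real.exp (-c)) * ENNReal.ofReal (x ^ ((1 - A) - 1) * Real.exp (-(c * x))) := by
      intro x hx
      have hx : 0 < x := hx
      have h1 : 0 < 1 + x := by linarith
      have h2 : 1 - 1 / (1 + x) = x / (1 + x) := by field_simp; ring
      rw [← ENNReal.ofReal_mul (by positivity), ← ENNReal.ofReal_mul (by positivity), h2, abs_div, abs_neg, abs_one,
        abs_of_pos (show 0 < (1 + x) ^ 2 by positivity),
        show -(c / (1 / (1 + x))) = -c + -(c * x) by field_simp; ring, Real.exp_add,
        Real.div_rpow hx.le h1.le, Real.div_rpow zero_le_one h1.le,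
        Real.one_rpow, Real.rpow_sub h1, show 1 - A - 1 = -A by ring, Real.rpow_neg h1.le, Real.rpow_two]
      congr 1
      have := Real.rpow_pos_of_pos h1 A
      field_simp
    rw [setLIntegral_congr_fun measurableSet_Ioi e, lintegral_const_mul' _ _ ENNReal.ofReal_ne_top,
      li_gamma (by linarith) hc, ← ENNReal.ofReal_mul (by positivity)]
    congr 1
    rw [show -(1 - A) = A - 1 by ring]; ring
  · intro x hx
    have hx : (0:ℝ) < x := hx
    have h1 : 1 + x ≠ 0 := by linarith
    exact ((hasDerivAt_const x (1:ℝ)).div ((hasDerivAt_id' x).const_add 1) h1).congr_deriv (by simp)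
  · intro x hx
    have hx : (0:ℝ) < x := hx
    exact ⟨by positivity, by rw [div_lt_one] <;> linarith⟩
  · intro y hy
    exact div_pos (by linarith [hy.2]) hy.1
  · intro x hx
    have hx : (0:ℝ) < x := hx
    have h1 : 1 + x ≠ 0 := by linarith
    field_simp; ring
  · intro y hy
    have h1 : y ≠ 0 := by linarith [hy.1]
    field_simp; ring

lemma GA_eq {A u : ℝ} (h0 : 0 < A) (h1 : A < 1) (hu : 0 < u) :
    ∫⁻ p, ENNReal.ofReal ((Real.Gamma A)⁻¹ * p.1 ^ (A - 1) * (1 - p.1) ^ (-A) * (p.2 ^ (A - 1) * Real.exp (-p.2))) *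
        ENNReal.ofReal ((p.1 * p.2)⁻¹ * Real.exp (-(u / (p.1 * p.2))))
      ∂((volume.restrict (Ioo (0:ℝ) 1)).prod (volume.restrict (Ioi (0:ℝ)))) =
    ENNReal.ofReal (Real.Gamma (1 - A) / Real.Gamma A * u ^ (A - 1)) * TT u := by
  rw [lintegral_prod_symm _ (by fun_prop)]
  have hG := Real.Gamma_pos_of_pos h0
  have hG1 := Real.Gamma_pos_of_pos (show 0 < 1 - A by linarith)
  unfold TT
  rw [← lintegral_const_mul' _ _ ENNReal.ofReal_ne_top]
  refine setLIntegral_congr_fun measurableSet_Ioi fun x hx => ?_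
  have hx : 0 < x := hx
  have e : ∀ s ∈ Ioo (0:ℝ) 1, ENNReal.ofReal ((Real.Gamma A)⁻¹ * s ^ (A - 1) * (1 - s) ^ (-A) * (x ^ (A - 1) * Real.exp (-x))) *
        ENNReal.ofReal ((s * x)⁻¹ * Real.exp (-(u / (s * x)))) =
      ENNReal.ofReal ((Real.Gamma A)⁻¹ * (x ^ (A - 1) * Real.exp (-x)) * x⁻¹) *
        ENNReal.ofReal (s ^ (A - 2) * (1 - s) ^ (-A) * Real.exp (-((u / x) / s))) := by
    intro s hs
    obtain ⟨hs0, hs1⟩ := hs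
    have h1 : 0 < 1 - s := by linarith
    rw [← ENNReal.ofReal_mul (by positivity), ← ENNReal.ofReal_mul (by positivity),
      show u / (s * x) = (u / x) / s by field_simp, show A - 2 = (A - 1) - 1 by ring, Real.rpow_sub_one hs0.ne' (A - 1)]
    congr 1; field_simp
  simp only
  rw [setLIntegral_congr_fun measurableSet_Ioo e, lintegral_const_mul' _ _ ENNReal.ofReal_ne_top,
    inner_s h1 (by positivity), ← ENNReal.ofReal_mul (by positivity), ← ENNReal.ofReal_mul (by positivity)]
  congr 1
  rw [Real.div_rpow hu.le hx.le, sub_eq_add_neg (-x), Real.exp_add]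
  have := Real.rpow_pos_of_pos hx (A - 1)
  field_simp

lemma T_sq {N : ℝ} (hN : 0 < N) :
    ∫⁻ u in Ioi (0:ℝ), ENNReal.ofReal (u ^ (N - 1)) * (TT u * TT u) =
      ENNReal.ofReal (Real.Gamma N ^ 4 / Real.Gamma (2 * N)) := by
  have hG := Real.Gamma_pos_of_pos hN
  have e1 : ∀ u : ℝ, ENNReal.ofReal (u ^ (N - 1)) * (TT u * TT u) =
    ∫⁻ P, ENNReal.ofReal (u ^ (N - 1)) * (ENNReal.ofReal (Real.exp (-P.1 - u / P.1) / P.1) *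
      ENNReal.ofReal (Real.exp (-P.2 - u / P.2) / P.2))
      ∂((volume.restrict (Ioi (0:ℝ))).prod (volume.restrict (Ioi (0:ℝ)))) := by
    intro u
    rw [lintegral_const_mul' _ _ ENNReal.ofReal_ne_top]
    congr 1
    unfold TT
    rw [← lintegral_prod_mul] <;> fun_prop
  simp_rw [e1]
  rw [lintegral_lintegral_swap (by fun_prop), lintegral_prod _ (by
    apply Measurable.aemeasurable
    apply Measurable.lintegral_prod_left'
      (f := fun q : ℝ × (ℝ × ℝ) => ENNReal.ofReal (q.1 ^ (N - 1)) * (ENNReal.ofReal (Real.exp (-q.2.1 - q.1 / q.2.1) / q.2.1) *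
      ENNReal.ofReal (Real.exp (-q.2.2 - q.1 / q.2.2) / q.2.2)))
    fun_prop)]
  have e2 : ∀ x ∈ Ioi (0:ℝ), (∫⁻ y in Ioi (0:ℝ), ∫⁻ u in Ioi (0:ℝ), ENNReal.ofReal (u ^ (N - 1)) *
      (ENNReal.ofReal (Real.exp (-x - u / x) / x) * ENNReal.ofReal (Real.exp (-y - u / y) / y))) =
      ∫⁻ h in Ioi (0:ℝ), ENNReal.ofReal (Real.Gamma N * h ^ (N - 1) * (1 + h) ^ (-N)) *
        ENNReal.ofReal (x ^ (N - 1) * Real.exp (-((1 + h) * x))) := by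
    intro x hx
    have hx : 0 < x := hx
    rw [li_subst (s := Ioi 0) (t := Ioi 0) (fun h => x * h) (fun y => y / x) (fun _ => x) measurableSet_Ioi]
    · refine setLIntegral_congr_fun measurableSet_Ioi fun h hh => ?_
      have hh : 0 < h := hh
      have e3 : ∀ u ∈ Ioi (0:ℝ), ENNReal.ofReal (u ^ (N - 1)) *
        (ENNReal.ofReal (Real.exp (-x - u / x) / x) * ENNReal.ofReal (Real.exp (-(x*h) - u / (x*h)) / (x*h))) =
        ENNReal.ofReal (Real.exp (-((1+h)*x)) / (x * (x * h))) * ENNReal.ofReal (u ^ (N - 1) * Real.exp (-(((1 + h) / (x*h)) * u))) := by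
        intro u hu
        have hu : 0 < u := hu
        rw [← ENNReal.ofReal_mul (by positivity), ← ENNReal.ofReal_mul (by positivity), ← ENNReal.ofReal_mul (by positivity)]
        congr 1
        have : Real.exp (-x - u / x) * Real.exp (-(x*h) - u / (x*h)) = Real.exp (-((1+h)*x)) * Real.exp (-(((1 + h) / (x*h)) * u)) := by
          rw [← Real.exp_add, ← Real.exp_add]; congr 1; field_simp; ring
        rw [show u ^ (N - 1) * (Real.exp (-x - u / x) / x * (Real.exp (-(x*h) - u / (x*h)) / (x*h))) =
          u ^ (N - 1) * (Real.exp (-x - u / x) * Real.exp (-(x*h) - u / (x*h))) / (x * (x * h)) by field_simp, this]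
        field_simp
      rw [setLIntegral_congr_fun measurableSet_Ioi e3, lintegral_const_mul' _ _ ENNReal.ofReal_ne_top,
        li_gamma hN (by positivity), ← ENNReal.ofReal_mul (by positivity), ← ENNReal.ofReal_mul (by positivity), ← ENNReal.ofReal_mul (by positivity)]
      congr 1
      rw [abs_of_pos hx, Real.div_rpow (by positivity) (by positivity), Real.mul_rpow hx.le hh.le, Real.rpow_neg hx.le,
        Real.rpow_neg hh.le, Real.rpow_sub_one hh.ne', Real.rpow_sub_one hx.ne']
      have := Real.rpow_pos_of_pos hx N
      have := Real.rpow_pos_of_pos hh N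
      field_simp
    · intro y _; simpa using (hasDerivAt_id' y).const_mul x
    · intro y hy; exact mul_pos hx hy
    · intro y hy; exact div_pos hy hx
    · intro y hy; field_simp
    · intro y hy; field_simp
  simp only
  rw [setLIntegral_congr_fun measurableSet_Ioi e2, lintegral_lintegral_swap (by fun_prop)]
  have e4 : ∀ h ∈ Ioi (0:ℝ), (∫⁻ x in Ioi (0:ℝ), ENNReal.ofReal (Real.Gamma N * h ^ (N - 1) * (1 + h) ^ (-N)) *
        ENNReal.ofReal (x ^ (N - 1) * Real.exp (-((1 + h) * x)))) =
      ENNReal.ofReal (Real.Gamma N ^ 2) * ENNReal.ofReal (h ^ (N - 1) * (1 + h) ^ (-(N + N))) := by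
    intro h hh
    have hh : 0 < h := hh
    rw [lintegral_const_mul' _ _ ENNReal.ofReal_ne_top, li_gamma hN (by positivity), ← ENNReal.ofReal_mul (by positivity), ← ENNReal.ofReal_mul (by positivity),
      neg_add, Real.rpow_add (by positivity)]
    congr 1; ring
  rw [setLIntegral_congr_fun measurableSet_Ioi e4, lintegral_const_mul' _ _ ENNReal.ofReal_ne_top, li_beta_half hN hN,
    ← ENNReal.ofReal_mul (by positivity)]
  congr 1
  rw [← two_mul]; ring

lemma Q_lemma {A b : ℝ} (hA0 : 0 < A) (hA1 : A < 1) (hb0 : 0 < b) (hb1 : b < 1) (hN : 1 < A + b) :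
    ∫⁻ η in Ioi (0:ℝ), KA A η * KA b η =
      ENNReal.ofReal (Real.Gamma (1 - A) * Real.Gamma (1 - b) * Real.Gamma (A + b - 1) ^ 4 /
        (Real.Gamma (2 * (A + b - 1)) * Real.Gamma A * Real.Gamma b)) := by
  have hpos : ∀ᵐ p ∂((volume.restrict (Ioo (0:ℝ) 1)).prod (volume.restrict (Ioi (0:ℝ)))), 0 < p.1 * p.2 := by
    rw [Measure.prod_restrict]
    refine (ae_restrict_iff' (measurableSet_Ioo.prod measurableSet_Ioi)).2 (Filter.Eventually.of_forall fun p hp => ?_)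
    exact mul_pos hp.1.1 hp.2
  have e1 : ∀ η ∈ Ioi (0:ℝ), KA A η * KA b η = _ := fun η hη => by
    rw [KA_eq hA0 hη, KA_eq hb0 hη]
  rw [setLIntegral_congr_fun measurableSet_Ioi e1, li_laplace _ _ _ _ _ _ (by fun_prop) (by fun_prop) (by fun_prop) (by fun_prop) hpos hpos]
  have g1 := Real.Gamma_pos_of_pos (show 0 < 1 - A by linarith)
  have g2 := Real.Gamma_pos_of_pos (show 0 < 1 - b by linarith)
  have g3 := Real.Gamma_pos_of_pos hA0
  have g4 := Real.Gamma_pos_of_pos hb0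
  refine Eq.trans (setLIntegral_congr_fun measurableSet_Ioi (g := fun u => ENNReal.ofReal (Real.Gamma (1 - A) * Real.Gamma (1 - b) / (Real.Gamma A * Real.Gamma b)) *
     (ENNReal.ofReal (u ^ ((A + b - 1) - 1)) * (TT u * TT u))) fun u hu => ?_) ?_
  · have hu' : 0 < u := hu
    rw [GA_eq hA0 hA1 hu, GA_eq hb0 hb1 hu]
    beta_reduce
    rw [mul_mul_mul_comm, ← ENNReal.ofReal_mul (by positivity), ← mul_assoc (ENNReal.ofReal _) (ENNReal.ofReal _),
      ← ENNReal.ofReal_mul (by positivity)]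
    congr 2
    rw [show A + b - 1 - 1 = (A - 1) + (b - 1) by ring, Real.rpow_add hu]
    field_simp
  rw [lintegral_const_mul' _ _ ENNReal.ofReal_ne_top, T_sq (by linarith),
    ← ENNReal.ofReal_mul (by positivity)]
  congr 1
  field_simp

noncomputable def poch (a : ℝ) (k : ℕ) : ℝ := (ascPochhammer ℝ k).eval a

lemma poch_zero (a : ℝ) : poch a 0 = 1 := by simp [poch]
lemma poch_succ (a : ℝ) (k : ℕ) : poch a (k + 1) = poch a k * (a + k) := ascPochhammer_succ_eval k a
lemma poch_pos {a : ℝ} (ha : 0 < a) (k : ℕ) : 0 < poch a k := ascPochhammer_pos k a ha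
lemma fac_pos (k : ℕ) : 0 < (k.factorial : ℝ) := by exact_mod_cast k.factorial_pos

lemma Gamma_add_nat {a : ℝ} (ha : 0 < a) (k : ℕ) : Real.Gamma (a + k) = poch a k * Real.Gamma a := by
  induction k with
  | zero => simp [poch_zero]
  | succ k ih =>
    rw [poch_succ, Nat.cast_succ, ← add_assoc, Real.Gamma_add_one (by positivity), ih]; ring

lemma poch_two (s : ℝ) (k : ℕ) : poch (2 * s) (2 * k) = 4 ^ k * poch s k * poch (s + 1 / 2) k := by
  induction k with
  | zero => simp [poch_zero]
  | succ k ih =>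
    rw [show 2 * (k + 1) = 2 * k + 1 + 1 by ring, poch_succ, poch_succ, poch_succ, poch_succ, ih]
    push_cast; ring

lemma fac_two (k : ℕ) : ((2 * k).factorial : ℝ) = 4 ^ k * k.factorial * poch (1 / 2) k := by
  induction k with
  | zero => simp [poch_zero]
  | succ k ih =>
    rw [show 2 * (k + 1) = 2 * k + 1 + 1 by ring, Nat.factorial_succ, Nat.factorial_succ, Nat.factorial_succ, poch_succ]
    push_cast
    rw [ih]; ring

lemma hasSum_binom (a : ℝ) {t : ℝ} (ht : |t| < 1) :
    HasSum (fun k : ℕ => poch a k / k.factorial * t ^ k) ((1 - t) ^ (-a)) := by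
  have h := (Real.one_div_one_sub_rpow_hasFPowerSeriesOnBall_zero a).hasSum (y := t) (by
    simpa [Metric.mem_eball, edist_dist, Real.dist_eq] using ht)
  have ht' := abs_lt.1 ht
  have e : (1 - t) ^ (-a) = 1 / (1 - (0 + t)) ^ a := by
    rw [zero_add, Real.rpow_neg (by linarith), one_div]
  rw [e]
  have e2 : (fun k : ℕ => poch a k / k.factorial * t ^ k) =
      fun n => (FormalMultilinearSeries.ofScalars ℝ (fun n : ℕ => Ring.choose (a + ↑n - 1) n) n) fun _ => t := by
    funext k
    rw [FormalMultilinearSeries.ofScalars_apply_eq, smul_eq_mul]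
    congr 1
    rw [← Ring.multichoose_eq, div_eq_iff (fac_pos k).ne']
    have := Ring.factorial_nsmul_multichoose_eq_ascPochhammer a k
    rw [Polynomial.ascPochhammer_smeval_eq_eval] at this
    rw [poch, ← this, nsmul_eq_mul, mul_comm]
  rw [e2]; exact h

noncomputable def lc (a : ℝ) (k : ℕ) : ℝ := poch a k * poch (1 - a) k / (k.factorial : ℝ) ^ 2
noncomputable def lq (a z : ℝ) : ℝ := ∑' k, lc a k * z ^ k

lemma lc_symm (a : ℝ) (k : ℕ) : lc (1 - a) k = lc a k := by
  simp [lc]; ring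
lemma lq_symm (a z : ℝ) : lq (1 - a) z = lq a z := by simp [lq, lc_symm]
lemma lc_zero (a : ℝ) : lc a 0 = 1 := by simp [lc, poch_zero]
lemma lc_succ (a : ℝ) (k : ℕ) : lc a (k + 1) * ((k:ℝ) + 1) ^ 2 = lc a k * ((a + k) * (1 - a + k)) := by
  unfold lc
  rw [poch_succ, poch_succ, Nat.factorial_succ]
  have := (fac_pos k).ne'
  push_cast
  field_simp
lemma lc_pos {a : ℝ} (h0 : 0 < a) (h1 : a < 1) (k : ℕ) : 0 < lc a k := by
  have := poch_pos h0 k; have := poch_pos (show 0 < 1 - a by linarith) k; have := fac_pos k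
  unfold lc; positivity
lemma lc_le_one {a : ℝ} (h0 : 0 < a) (h1 : a < 1) (k : ℕ) : lc a k ≤ 1 := by
  induction k with
  | zero => rw [lc_zero]
  | succ k ih =>
    have h := lc_succ a k
    have hp := lc_pos h0 h1 k
    have hp' := lc_pos h0 h1 (k+1)
    have hk : (0:ℝ) ≤ k := k.cast_nonneg
    have : (a + k) * (1 - a + k) ≤ ((k:ℝ) + 1) ^ 2 := by nlinarith
    by_contra hc
    push Not at hc
    have : lc a k * ((a + k) * (1 - a + k)) ≤ 1 * ((k:ℝ) + 1) ^ 2 := by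
      apply mul_le_mul ih this _ zero_le_one
      exact mul_nonneg (by positivity) (by linarith)
    nlinarith [show (0:ℝ) < (k+1)^2 by positivity]

lemma lq_summable {a z : ℝ} (h0 : 0 < a) (h1 : a < 1) (hz : |z| < 1) : Summable (fun k => lc a k * z ^ k) := by
  refine Summable.of_norm_bounded (g := fun k => |z| ^ k) (summable_geometric_of_lt_one (abs_nonneg _) hz) fun k => ?_
  rw [norm_mul, norm_pow, Real.norm_eq_abs, Real.norm_eq_abs, abs_of_pos (lc_pos h0 h1 k)]
  exact mul_le_of_le_one_left (by positivity) (lc_le_one h0 h1 k)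

lemma one_le_lq {a z : ℝ} (h0 : 0 < a) (h1 : a < 1) (hz0 : 0 ≤ z) (hz : z < 1) : 1 ≤ lq a z := by
  have hs := lq_summable h0 h1 (show |z| < 1 by rwa [abs_of_nonneg hz0])
  have := hs.le_tsum 0 (fun k _ => mul_nonneg (lc_pos h0 h1 k).le (pow_nonneg hz0 k))
  simpa [lc_zero, lq] using this

lemma F1 {a z : ℝ} (h0 : 0 < a) (h1 : a < 1) (hz0 : 0 ≤ z) (hz : z < 1) :
    ∫⁻ s in Ioo (0:ℝ) 1, ENNReal.ofReal (s ^ (a - 1) * (1 - s) ^ (-a) * (1 - (1 - s) * z) ^ (-a))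
      = ENNReal.ofReal (Real.Gamma a * Real.Gamma (1 - a) * lq a z) := by
  have g1 := Real.Gamma_pos_of_pos h0
  have g2 := Real.Gamma_pos_of_pos (show 0 < 1 - a by linarith)
  have e : ∀ s ∈ Ioo (0:ℝ) 1, ENNReal.ofReal (s ^ (a - 1) * (1 - s) ^ (-a) * (1 - (1 - s) * z) ^ (-a)) =
      ∑' k : ℕ, ENNReal.ofReal (poch a k / k.factorial * z ^ k) *
        ENNReal.ofReal (s ^ (a - 1) * (1 - s) ^ ((1 - a + k) - 1)) := by
    intro s ⟨hs0, hs1⟩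
    have h1s : 0 < 1 - s := by linarith
    have hb := (hasSum_binom a (t := (1 - s) * z) (by rw [abs_of_nonneg (by positivity)]; nlinarith)).mul_left
      (s ^ (a - 1) * (1 - s) ^ (-a))
    rw [← hb.tsum_eq, ENNReal.ofReal_tsum_of_nonneg _ hb.summable]
    · congr 1; ext k
      have := poch_pos h0 k; have := fac_pos k
      rw [← ENNReal.ofReal_mul (by positivity), show (1 - a + k) - 1 = -a + k by ring,
        Real.rpow_add h1s, Real.rpow_natCast, mul_pow]
      congr 1; ring
    · intro k
      have := poch_pos h0 k; have := fac_pos k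
      positivity
  rw [setLIntegral_congr_fun measurableSet_Ioo e, lintegral_tsum (by intro k; fun_prop), lq, ← tsum_mul_left,
    ENNReal.ofReal_tsum_of_nonneg]
  · congr 1; ext k
    have := poch_pos h0 k; have := fac_pos k
    rw [lintegral_const_mul' _ _ ENNReal.ofReal_ne_top, li_beta h0 (by have := k.cast_nonneg (α := ℝ); linarith),
      ← ENNReal.ofReal_mul (by positivity), show a + (1 - a + k) = k + 1 by ring, Real.Gamma_nat_eq_factorial,
      Gamma_add_nat (by linarith)]
    congr 1
    unfold lc
    field_simp
  · intro k
    have := lc_pos h0 h1 k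
    positivity
  · exact (lq_summable h0 h1 (by rwa [abs_of_nonneg hz0])).mul_left _

lemma KA_lq {a η : ℝ} (h0 : 0 < a) (h1 : a < 1) (hη : 0 < η) :
    KA a η = ENNReal.ofReal (Real.Gamma a * Real.Gamma (1 - a) * (1 + η) ^ (-a) * lq a (η / (1 + η))) := by
  have g1 := Real.Gamma_pos_of_pos h0
  have g2 := Real.Gamma_pos_of_pos (show 0 < 1 - a by linarith)
  have hη1 : 0 < 1 + η := by linarith
  have hh := F1 h0 h1 (z := η / (1 + η)) (by positivity) (by rw [div_lt_one hη1]; linarith)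
  rw [show Real.Gamma a * Real.Gamma (1 - a) * (1 + η) ^ (-a) * lq a (η / (1 + η)) =
    (1 + η) ^ (-a) * (Real.Gamma a * Real.Gamma (1 - a) * lq a (η / (1 + η))) by ring,
    ENNReal.ofReal_mul (by positivity), ← hh, ← lintegral_const_mul' _ _ ENNReal.ofReal_ne_top]
  refine setLIntegral_congr_fun measurableSet_Ioo fun s ⟨hs0, hs1⟩ => ?_
  have h1s : 0 < 1 - s := by linarith
  rw [← ENNReal.ofReal_mul (by positivity), show 1 - (1 - s) * (η / (1 + η)) = (1 + s * η) / (1 + η) by field_simp; ring,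
    Real.div_rpow (by positivity) hη1.le]
  congr 1
  have := Real.rpow_pos_of_pos hη1 (-a)
  field_simp

lemma KA_euler {a η : ℝ} (h0 : 0 < a) (h1 : a < 1) (hη : 0 < η) :
    KA a η = ENNReal.ofReal ((1 + η) ^ (1 - 2 * a)) * KA (1 - a) η := by
  have hη1 : 0 < 1 + η := by linarith
  rw [KA_lq h0 h1 hη, KA_lq (by linarith) (by linarith) hη, ← ENNReal.ofReal_mul (by positivity), lq_symm,
    show 1 - (1 - a) = a by ring, show -a = (1 - 2 * a) + (-(1 - a)) by ring, Real.rpow_add hη1]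
  congr 1; ring

noncomputable def lgp (a x : ℝ) : ℝ := lq a ((1 - x) / 2)

lemma F3 {a x : ℝ} (h0 : 0 < a) (h1 : a < 1) (hx0 : -1 < x) (hx : x ≤ 1) :
    ∫⁻ ρ in Ioo (0:ℝ) 1, ENNReal.ofReal (2 ^ (1 - a) * (1 - ρ ^ 2) ^ (a - 1) * ρ ^ (-a) * (1 + ρ * x) ^ (-a))
      = ENNReal.ofReal (Real.Gamma a * Real.Gamma (1 - a) * lgp a x) := by
  unfold lgp
  rw [← F1 h0 h1 (by linarith) (by linarith)]
  symm
  rw [li_subst (s := Ioo 0 1) (t := Ioo 0 1) (fun ρ => (1 - ρ) / (1 + ρ)) (fun ρ => (1 - ρ) / (1 + ρ))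
    (fun ρ => -2 / (1 + ρ) ^ 2) measurableSet_Ioo]
  · refine setLIntegral_congr_fun measurableSet_Ioo fun ρ ⟨hs0, hs1⟩ => ?_
    have p1 : 0 < 1 + ρ := by linarith
    have p2 : 0 < 1 - ρ := by linarith
    have p3 : 0 < 1 + ρ * x := by nlinarith
    have q1 : 1 - (1 - ρ) / (1 + ρ) = 2 * ρ / (1 + ρ) := by field_simp; ring
    have q2 : 1 - (1 - (1 - ρ) / (1 + ρ)) * ((1 - x) / 2) = (1 + ρ * x) / (1 + ρ) := by field_simp; ring
    rw [← ENNReal.ofReal_mul (by positivity), q2, q1, abs_div, abs_neg, abs_two, abs_of_pos (show 0 < (1 + ρ) ^ 2 by positivity),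
      Real.div_rpow (by positivity) (by positivity), Real.div_rpow (by positivity) (by positivity),
      Real.div_rpow (by positivity) (by positivity), Real.mul_rpow (by positivity) (by positivity),
      show 1 - ρ ^ 2 = (1 - ρ) * (1 + ρ) by ring, Real.mul_rpow (by positivity) (by positivity),
      Real.rpow_neg p1.le, Real.rpow_sub two_pos, Real.rpow_neg two_pos.le, Real.rpow_sub_one p1.ne', Real.rpow_one]
    have := Real.rpow_pos_of_pos p1 a
    congr 1
    field_simp
  · intro ρ hρ
    have h1 : 1 + ρ ≠ 0 := by linarith [hρ.1]
    exact (((hasDerivAt_id' ρ).const_sub 1).div ((hasDerivAt_id' ρ).const_add 1) h1).congr_deriv (by ring)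
  · intro ρ hρ
    have := hρ.1; have := hρ.2
    exact ⟨div_pos (by linarith) (by linarith), by rw [div_lt_one] <;> linarith⟩
  · intro ρ hρ
    have := hρ.1; have := hρ.2
    exact ⟨div_pos (by linarith) (by linarith), by rw [div_lt_one] <;> linarith⟩
  · intro ρ hρ
    have h1 : 1 + ρ ≠ 0 := by linarith [hρ.1]
    field_simp; ring
  · intro ρ hρ
    have h1 : 1 + ρ ≠ 0 := by linarith [hρ.1]
    field_simp; ring

lemma F3q {a x : ℝ} (h0 : 0 < a) (h1 : a < 1) (hx0 : -1 < x) (hx : x ≤ 1) :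
    ∫⁻ q in Ioo (0:ℝ) 1, ENNReal.ofReal (2 ^ (- a) * (1 - q) ^ (a - 1) * q ^ (-a / 2 - 1 / 2) * (1 + √q * x) ^ (-a))
      = ENNReal.ofReal (Real.Gamma a * Real.Gamma (1 - a) * lgp a x) := by
  rw [← F3 h0 h1 hx0 hx]
  rw [li_subst (s := Ioo 0 1) (t := Ioo 0 1) (fun ρ => ρ ^ 2) (fun q => √q)
    (fun ρ => 2 * ρ) measurableSet_Ioo]
  · refine setLIntegral_congr_fun measurableSet_Ioo fun ρ ⟨hs0, hs1⟩ => ?_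
    have p3 : 0 < 1 + ρ * x := by nlinarith
    have p2 : 0 < 1 - ρ ^ 2 := by nlinarith
    rw [← ENNReal.ofReal_mul (by positivity), Real.sqrt_sq hs0.le, abs_of_pos (by positivity),
      ← Real.rpow_natCast_mul hs0.le, Nat.cast_two, show 2 * (-a / 2 - 1 / 2) = -a - 1 by ring, Real.rpow_sub_one hs0.ne',
      show 1 - a = -a + 1 by ring, Real.rpow_add_one two_ne_zero]
    congr 1
    field_simp
  · intro ρ hρ
    simpa using hasDerivAt_pow 2 ρ
  · intro ρ ⟨h0, h1⟩
    exact ⟨by positivity, by nlinarith⟩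
  · intro ρ ⟨h0, h1⟩
    exact ⟨by positivity, by rw [Real.sqrt_lt' one_pos]; simpa using h1⟩
  · intro ρ hρ
    exact Real.sqrt_sq hρ.1.le
  · intro ρ hρ
    exact Real.sq_sqrt hρ.1.le

lemma hasSum_even_binom (a : ℝ) {t : ℝ} (ht : |t| < 1) :
    HasSum (fun k : ℕ => poch a (2 * k) / (2 * k).factorial * (t ^ 2) ^ k) (((1 - t) ^ (-a) + (1 + t) ^ (-a)) / 2) := by
  have h1 := hasSum_binom a ht
  have h2 := hasSum_binom a (t := -t) (by rwa [abs_neg])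
  have h := (h1.add h2).div_const 2
  rw [sub_neg_eq_add] at h
  have hinj : Function.Injective (fun k : ℕ => 2 * k) := fun a b h => by simpa using h
  rw [← hinj.hasSum_iff] at h
  · rw [add_comm ((1 - t) ^ (-a))] at h ⊢
    have e : (fun k : ℕ => poch a (2 * k) / (2 * k).factorial * (t ^ 2) ^ k) =
      (fun k : ℕ => (poch a k / k.factorial * t ^ k + poch a k / k.factorial * (-t) ^ k) / 2) ∘ (fun k => 2 * k) := by
      funext k
      simp only [Function.comp]
      rw [neg_pow, pow_mul, pow_mul, neg_one_sq, one_pow]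
      ring
    rw [e]; exact h
  · intro k hk
    have : Odd k := by
      rw [← Nat.not_even_iff_odd]
      rintro ⟨m, rfl⟩
      exact hk ⟨m, by simp; ring⟩
    rw [this.neg_pow]; ring

lemma F2 {σ x : ℝ} (h0 : 0 < σ) (h1 : σ < 1 / 2) (hx0 : -1 < x) (hx : x < 1) :
    ENNReal.ofReal (2 ^ (1 - 2 * σ) * √π / (Real.Gamma (1 - 2 * σ) * Real.Gamma (σ + 1 / 2) * Real.Gamma σ)) *
    ∫⁻ q in Ioo (0:ℝ) 1, ENNReal.ofReal (q ^ (-σ - 1 / 2) * (1 - q) ^ (σ - 1) * (1 - q * x ^ 2) ^ (-σ))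
      = ENNReal.ofReal (lgp (2 * σ) x + lgp (2 * σ) (-x)) := by
  have g1 := Real.Gamma_pos_of_pos h0
  have g2 := Real.Gamma_pos_of_pos (show 0 < 1 - 2 * σ by linarith)
  have g3 := Real.Gamma_pos_of_pos (show 0 < σ + 1 / 2 by linarith)
  have g4 := Real.Gamma_pos_of_pos (show 0 < 2 * σ by linarith)
  have g5 := Real.Gamma_pos_of_pos (show 0 < 1 / 2 - σ by linarith)
  have hpi : 0 < √π := by positivity
  have pp1 : 0 < lgp (2 * σ) x := lt_of_lt_of_le one_pos (one_le_lq (by linarith) (by linarith) (by linarith) (by linarith))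
  have pp2 : 0 < lgp (2 * σ) (-x) := lt_of_lt_of_le one_pos (one_le_lq (by linarith) (by linarith) (by linarith) (by linarith))
  -- right integral
  have R : ∫⁻ q in Ioo (0:ℝ) 1, ENNReal.ofReal (q ^ (-σ - 1 / 2) * (1 - q) ^ (σ - 1) * (1 - q * x ^ 2) ^ (-σ)) =
      ∑' k : ℕ, ENNReal.ofReal (poch σ k * (x ^ 2) ^ k * Real.Gamma (1 / 2 - σ + k) / (k.factorial * poch (1 / 2) k) * (Real.Gamma σ / √π)) := by
    have e : ∀ s ∈ Ioo (0:ℝ) 1, ENNReal.ofReal (s ^ (-σ - 1 / 2) * (1 - s) ^ (σ - 1) * (1 - s * x ^ 2) ^ (-σ)) =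
        ∑' k : ℕ, ENNReal.ofReal (poch σ k / k.factorial * (x ^ 2) ^ k) *
          ENNReal.ofReal (s ^ ((1 / 2 - σ + k) - 1) * (1 - s) ^ (σ - 1)) := by
      intro s ⟨hs0, hs1⟩
      have h1s : 0 < 1 - s := by linarith
      have hb := (hasSum_binom σ (t := s * x ^ 2) (by rw [abs_of_nonneg (by positivity)]; nlinarith)).mul_left
        (s ^ (-σ - 1 / 2) * (1 - s) ^ (σ - 1))
      rw [← hb.tsum_eq, ENNReal.ofReal_tsum_of_nonneg _ hb.summable]
      · congr 1; ext k
        have := poch_pos h0 k; have := fac_pos k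
        rw [← ENNReal.ofReal_mul (by positivity), show (1 / 2 - σ + k) - 1 = (-σ - 1 / 2) + k by ring,
          Real.rpow_add hs0, Real.rpow_natCast, mul_pow]
        congr 1; ring
      · intro k
        have := poch_pos h0 k; have := fac_pos k
        positivity
    rw [setLIntegral_congr_fun measurableSet_Ioo e, lintegral_tsum (by intro k; fun_prop)]
    congr 1; ext k
    have := poch_pos h0 k; have := fac_pos k; have := poch_pos (show (0:ℝ) < 1 / 2 by norm_num) k
    have hk := k.cast_nonneg (α := ℝ)
    rw [lintegral_const_mul' _ _ ENNReal.ofReal_ne_top, li_beta (by linarith) h0,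
      ← ENNReal.ofReal_mul (by positivity), show (1 / 2 - σ + k) + σ = 1 / 2 + k by ring, 
      Gamma_add_nat (show (0:ℝ) < 1 / 2 by norm_num), Real.Gamma_one_half_eq]
    congr 1
    field_simp
  have Lx : ENNReal.ofReal (Real.Gamma (2 * σ) * Real.Gamma (1 - 2 * σ) * lgp (2 * σ) x) + 
      ENNReal.ofReal (Real.Gamma (2 * σ) * Real.Gamma (1 - 2 * σ) * lgp (2 * σ) (-x)) =
      ∑' k : ℕ, ENNReal.ofReal (2 ^ (1 - 2 * σ) * Real.Gamma (2 * σ) / Real.Gamma (σ + 1 / 2)) *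
        ENNReal.ofReal (poch σ k * (x ^ 2) ^ k * Real.Gamma (1 / 2 - σ + k) / (k.factorial * poch (1 / 2) k)) := by
    rw [← F3q (by linarith) (by linarith) (by linarith) (by linarith), ← F3q (by linarith) (by linarith) (by linarith) (by linarith),
      ← lintegral_add_left (by fun_prop)]
    have e : ∀ s ∈ Ioo (0:ℝ) 1, ENNReal.ofReal (2 ^ (-(2 * σ)) * (1 - s) ^ (2 * σ - 1) * s ^ (-(2 * σ) / 2 - 1 / 2) * (1 + √s * x) ^ (-(2 * σ))) +
         ENNReal.ofReal (2 ^ (-(2 * σ)) * (1 - s) ^ (2 * σ - 1) * s ^ (-(2 * σ) / 2 - 1 / 2) * (1 + √s * (-x)) ^ (-(2 * σ))) =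
        ∑' k : ℕ, ENNReal.ofReal (2 ^ (1 - 2 * σ) * poch (2 * σ) (2 * k) / (2 * k).factorial * (x ^ 2) ^ k) *
          ENNReal.ofReal (s ^ ((1 / 2 - σ + k) - 1) * (1 - s) ^ (2 * σ - 1)) := by
      intro s ⟨hs0, hs1⟩
      have h1s : 0 < 1 - s := by linarith
      have hsq : √s < 1 := by rw [Real.sqrt_lt' one_pos]; simpa using hs1
      have hsq0 : 0 < √s := Real.sqrt_pos.2 hs0
      have habs : |√s * x| < 1 := by
        rw [abs_lt]; constructor <;> nlinarith
      have a1 : 0 < 1 + √s * x := by linarith [(abs_lt.1 habs).1]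
      have a2 : 0 < 1 + √s * (-x) := by linarith [(abs_lt.1 habs).2]
      have hb := (hasSum_even_binom (2 * σ) habs).mul_left
        (2 ^ (1 - 2 * σ) * s ^ (-σ - 1 / 2) * (1 - s) ^ (2 * σ - 1))
      rw [← ENNReal.ofReal_add (by positivity) (by positivity)]
      rw [show 2 ^ (-(2 * σ)) * (1 - s) ^ (2 * σ - 1) * s ^ (-(2 * σ) / 2 - 1 / 2) * (1 + √s * x) ^ (-(2 * σ)) +
        2 ^ (-(2 * σ)) * (1 - s) ^ (2 * σ - 1) * s ^ (-(2 * σ) / 2 - 1 / 2) * (1 + √s * (-x)) ^ (-(2 * σ)) =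
        (2 ^ (1 - 2 * σ) * s ^ (-σ - 1 / 2) * (1 - s) ^ (2 * σ - 1)) * (((1 - √s * x) ^ (-(2 * σ)) + (1 + √s * x) ^ (-(2 * σ))) / 2) by
          rw [show 1 - 2 * σ = -(2 * σ) + 1 by ring, Real.rpow_add_one two_ne_zero, show -(2 * σ) / 2 - 1 / 2 = -σ - 1 / 2 by ring,
            show 1 + √s * (-x) = 1 - √s * x by ring]
          ring]
      rw [← hb.tsum_eq, ENNReal.ofReal_tsum_of_nonneg _ hb.summable]
      · congr 1; ext k
        have := poch_pos (show 0 < 2 * σ by linarith) (2 * k); have := fac_pos (2 * k)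
        rw [← ENNReal.ofReal_mul (by positivity), show (1 / 2 - σ + k) - 1 = (-σ - 1 / 2) + k by ring,
          Real.rpow_add hs0, Real.rpow_natCast, mul_pow (√s), Real.sq_sqrt hs0.le, mul_pow]
        congr 1; ring
      · intro k
        have := poch_pos (show 0 < 2 * σ by linarith) (2 * k); have := fac_pos (2 * k)
        positivity
    rw [setLIntegral_congr_fun measurableSet_Ioo e, lintegral_tsum (by intro k; fun_prop)]
    congr 1; ext k
    have := poch_pos h0 k; have := fac_pos k; have := poch_pos (show (0:ℝ) < 1 / 2 by norm_num) k
    have := poch_pos (show (0:ℝ) < σ + 1 / 2 by linarith) k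
    have := poch_pos (show 0 < 2 * σ by linarith) (2 * k); have := fac_pos (2 * k)
    have hk := k.cast_nonneg (α := ℝ)
    have g6 := Real.Gamma_pos_of_pos (show 0 < 1 / 2 - σ + k by linarith)
    rw [lintegral_const_mul' _ _ ENNReal.ofReal_ne_top, li_beta (by linarith) (by linarith),
      ← ENNReal.ofReal_mul (by positivity), show (1 / 2 - σ + k) + 2 * σ = (σ + 1 / 2) + k by ring, 
      Gamma_add_nat (show (0:ℝ) < σ + 1 / 2 by linarith), ← ENNReal.ofReal_mul (by positivity), poch_two, fac_two]
    congr 1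
    generalize poch (σ + 1 / 2) k = P1 at *
    field_simp
  have key : ENNReal.ofReal (Real.Gamma (2 * σ) * Real.Gamma (1 - 2 * σ)) * ENNReal.ofReal (lgp (2 * σ) x + lgp (2 * σ) (-x)) = 
     ENNReal.ofReal (Real.Gamma (2 * σ) * Real.Gamma (1 - 2 * σ)) * 
    (ENNReal.ofReal (2 ^ (1 - 2 * σ) * √π / (Real.Gamma (1 - 2 * σ) * Real.Gamma (σ + 1 / 2) * Real.Gamma σ)) *
    ∫⁻ q in Ioo (0:ℝ) 1, ENNReal.ofReal (q ^ (-σ - 1 / 2) * (1 - q) ^ (σ - 1) * (1 - q * x ^ 2) ^ (-σ))) := by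
    rw [← ENNReal.ofReal_mul (by positivity), mul_add, ENNReal.ofReal_add (by positivity) (by positivity), Lx, R,
      ← ENNReal.tsum_mul_left, ← ENNReal.tsum_mul_left]
    congr 1; ext k
    have := poch_pos h0 k; have := fac_pos k; have := poch_pos (show (0:ℝ) < 1 / 2 by norm_num) k
    have hk := k.cast_nonneg (α := ℝ)
    have g6 := Real.Gamma_pos_of_pos (show 0 < 1 / 2 - σ + k by linarith)
    rw [← ENNReal.ofReal_mul (by positivity), ← ENNReal.ofReal_mul (by positivity), ← ENNReal.ofReal_mul (by positivity)]
    congr 1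
    field_simp
  symm
  refine (ENNReal.mul_right_inj ?_ ENNReal.ofReal_ne_top).1 key
  rw [Ne, ENNReal.ofReal_eq_zero, not_le]; positivity

def PolyBd (c : ℕ → ℝ) : Prop := ∃ (C : ℝ) (m : ℕ), 0 ≤ C ∧ ∀ k, |c k| ≤ C * ((k:ℝ) + 1) ^ m
noncomputable def SS (c : ℕ → ℝ) (z : ℝ) : ℝ := ∑' k, c k * z ^ k
def dc (c : ℕ → ℝ) (k : ℕ) : ℝ := (k + 1) * c (k + 1)

lemma PolyBd.dc {c : ℕ → ℝ} (h : PolyBd c) : PolyBd (dc c) := by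
  obtain ⟨C, m, hC, h⟩ := h
  refine ⟨C * 2 ^ m, m + 1, by positivity, fun k => ?_⟩
  have hk : (0:ℝ) ≤ k := k.cast_nonneg
  have h1 := h (k + 1)
  unfold _root_.dc
  rw [abs_mul, abs_of_pos (by positivity : (0:ℝ) < k + 1)]
  have h2 : (((k + 1 : ℕ) : ℝ) + 1) ^ m ≤ (2 * ((k:ℝ) + 1)) ^ m := by
    gcongr; push_cast; linarith
  calc ((k:ℝ) + 1) * |c (k + 1)| ≤ (k + 1) * (C * (2 * ((k:ℝ) + 1)) ^ m) := by
        gcongr; exact h1.trans (by gcongr)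
    _ = _ := by rw [mul_pow, pow_succ]; ring

lemma summable_poly {r : ℝ} (m : ℕ) (h0 : 0 ≤ r) (h1 : r < 1) : Summable (fun k : ℕ => ((k:ℝ) + 1) ^ m * r ^ k) := by
  rcases h0.eq_or_lt with rfl | hr
  · refine summable_of_ne_finset_zero (s := {0}) fun k hk => ?_
    have : k ≠ 0 := by simpa using hk
    simp [this]
  have h := summable_pow_mul_geometric_of_norm_lt_one (R := ℝ) m (r := r) (by rwa [Real.norm_eq_abs, abs_of_nonneg h0])
  rw [← summable_nat_add_iff 1] at h
  refine (h.mul_left r⁻¹).congr fun k => ?_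
  push_cast
  rw [pow_succ]; field_simp

lemma PolyBd.summable {c : ℕ → ℝ} (h : PolyBd c) {z : ℝ} (hz : |z| < 1) : Summable (fun k => c k * z ^ k) := by
  obtain ⟨C, m, hC, h⟩ := h
  refine Summable.of_norm_bounded ((summable_poly m (abs_nonneg z) hz).mul_left C) fun k => ?_
  rw [norm_mul, norm_pow, Real.norm_eq_abs, Real.norm_eq_abs, ← mul_assoc]
  gcongr; exact h k

lemma SS_hasDerivAt {c : ℕ → ℝ} (h : PolyBd c) {z : ℝ} (hz : |z| < 1) : HasDerivAt (SS c) (SS (dc c) z) z := by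
  obtain ⟨r, hr1, hr2⟩ := exists_between hz
  have hr0 : 0 < r := (abs_nonneg z).trans_lt hr1
  have hs := (h.dc.summable (z := r) (by rwa [abs_of_pos hr0])).abs
  have key : HasDerivAt (fun z => ∑' k, c k * z ^ k) (∑' k, c k * (k * z ^ (k - 1))) z := by
    refine hasDerivAt_tsum_of_isPreconnected (u := fun k => |c k| * (k * r ^ (k - 1))) (t := Metric.ball (0:ℝ) r) (y₀ := (0:ℝ))
      (g := fun k z => c k * z ^ k) (g' := fun k z => c k * (k * z ^ (k - 1)))
      ?_ Metric.isOpen_ball (convex_ball _ _).isPreconnected ?_ ?_ ?_ ?_ ?_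
    · rw [← summable_nat_add_iff 1]
      convert hs using 2 with k
      unfold dc
      rw [abs_mul, abs_mul, abs_of_nonneg (by positivity : (0:ℝ) ≤ k + 1), abs_of_nonneg (by positivity : 0 ≤ r ^ k)]
      simp; ring
    · intro k y _
      exact (hasDerivAt_pow k y).const_mul (c k)
    · intro k y hy
      have hy : |y| < r := by simpa using hy
      rw [norm_mul, norm_mul, norm_pow, Real.norm_eq_abs, Real.norm_eq_abs, Real.norm_eq_abs, abs_of_nonneg (k.cast_nonneg (α := ℝ))]
      gcongr
    · simpa using hr0
    · exact h.summable (by simp)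
    · simpa using hr1
  have e : SS (dc c) z = ∑' k, c k * (k * z ^ (k - 1)) := by
    rw [tsum_eq_zero_add']
    · simp [SS, dc]
      congr 1; ext k; ring
    · convert h.dc.summable hz using 2 with k
      simp [dc]; ring
  rw [e]; exact key

lemma SS_mul (c : ℕ → ℝ) (h : PolyBd c) {z : ℝ} (hz : |z| < 1) : z * SS (dc c) z = SS (fun k => k * c k) z ∧ 
    Summable (fun k : ℕ => (k * c k) * z ^ k) := by
  have hs := (h.dc.summable hz).mul_left z
  have e : (fun k => z * (dc c k * z ^ k)) = fun k => (((k + 1 : ℕ) : ℝ) * c (k + 1)) * z ^ (k + 1) := by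
    ext k; simp [dc]; ring
  have hs2 := hs
  rw [e] at hs2
  have t := tsum_eq_zero_add' (f := fun k : ℕ => ((k:ℝ) * c k) * z ^ k) hs2
  refine ⟨?_, (summable_nat_add_iff (f := fun k : ℕ => ((k:ℝ) * c k) * z ^ k) 1).1 hs2⟩
  rw [SS, SS, ← tsum_mul_left, e, t]
  simp

lemma lc_polyBd {a : ℝ} (h0 : 0 < a) (h1 : a < 1) : PolyBd (lc a) :=
  ⟨1, 0, zero_le_one, fun k => by rw [abs_of_pos (lc_pos h0 h1 k)]; simpa using lc_le_one h0 h1 k⟩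

lemma lq_ode {a z : ℝ} (h0 : 0 < a) (h1 : a < 1) (hz : |z| < 1) :
    z * (1 - z) * SS (dc (dc (lc a))) z + (1 - 2 * z) * SS (dc (lc a)) z - a * (1 - a) * lq a z = 0 := by
  have hb := lc_polyBd h0 h1
  obtain ⟨e1, s1⟩ := SS_mul _ hb hz
  obtain ⟨e2, s2⟩ := SS_mul _ hb.dc hz
  have hb3 : PolyBd (fun k : ℕ => ((k:ℝ) - 1) * lc a k) := by
    refine ⟨1, 1, zero_le_one, fun k => ?_⟩
    rw [abs_mul, abs_of_pos (lc_pos h0 h1 k), one_mul, pow_one]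
    have := lc_le_one h0 h1 k
    have h2 : |(k:ℝ) - 1| ≤ k + 1 := by rw [abs_le]; constructor <;> linarith [k.cast_nonneg (α := ℝ)]
    exact (mul_le_of_le_one_right (abs_nonneg _) this).trans h2
  obtain ⟨e3, s3⟩ := SS_mul _ hb3 hz
  have e4 : dc (fun k : ℕ => ((k:ℝ) - 1) * lc a k) = fun k => k * dc (lc a) k := by
    ext k; simp [dc]; ring
  rw [e4, ← e2] at e3
  have expand : z * (1 - z) * SS (dc (dc (lc a))) z + (1 - 2 * z) * SS (dc (lc a)) z - a * (1 - a) * lq a z =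
    z * SS (dc (dc (lc a))) z - z * (z * SS (dc (dc (lc a))) z) + SS (dc (lc a)) z - 2 * (z * SS (dc (lc a)) z) - a * (1 - a) * lq a z := by ring
  rw [expand, e3, e2, e1]
  have S := ((((s2.hasSum.sub s3.hasSum).add (hb.dc.summable hz).hasSum).sub (s1.hasSum.mul_left 2)).sub ((hb.summable hz).hasSum.mul_left (a * (1 - a))))
  refine S.unique ?_
  convert hasSum_zero using 2 with k
  have := lc_succ a k
  simp only [dc]
  linear_combination z ^ k * this

noncomputable def lp1 (a x : ℝ) : ℝ := - SS (dc (lc a)) ((1 - x) / 2) / 2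
noncomputable def lp2 (a x : ℝ) : ℝ := SS (dc (dc (lc a))) ((1 - x) / 2) / 4

lemma arg_lt {x : ℝ} (h : -1 < x) (h' : x < 3) : |(1 - x) / 2| < 1 := by
  rw [abs_lt]; constructor <;> linarith

lemma lgp_deriv {a x : ℝ} (h0 : 0 < a) (h1 : a < 1) (h : -1 < x) (h' : x < 3) : HasDerivAt (lgp a) (lp1 a x) x := by
  have e : HasDerivAt (fun x : ℝ => (1 - x) / 2) (-1/2) x := ((hasDerivAt_id' x).const_sub 1).div_const 2
  have := (SS_hasDerivAt (lc_polyBd h0 h1) (arg_lt h h')).comp x e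
  exact this.congr_deriv (by unfold lp1; ring)

lemma lp1_deriv {a x : ℝ} (h0 : 0 < a) (h1 : a < 1) (h : -1 < x) (h' : x < 3) : HasDerivAt (lp1 a) (lp2 a x) x := by
  have e : HasDerivAt (fun x : ℝ => (1 - x) / 2) (-1/2) x := ((hasDerivAt_id' x).const_sub 1).div_const 2
  have := (((SS_hasDerivAt (lc_polyBd h0 h1).dc (arg_lt h h')).comp x e).neg).div_const 2
  exact this.congr_deriv (by unfold lp2; ring)

lemma lp2_cont {a x : ℝ} (h0 : 0 < a) (h1 : a < 1) (h : -1 < x) (h' : x < 3) : ContinuousAt (lp2 a) x := by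
  have e : HasDerivAt (fun x : ℝ => (1 - x) / 2) (-1/2) x := ((hasDerivAt_id' x).const_sub 1).div_const 2
  have := (((SS_hasDerivAt (lc_polyBd h0 h1).dc.dc (arg_lt h h')).comp x e)).div_const 4
  exact this.continuousAt

lemma lgp_ode {a x : ℝ} (h0 : 0 < a) (h1 : a < 1) (h : -1 < x) (h' : x < 3) :
    (1 - x ^ 2) * lp2 a x - 2 * x * lp1 a x = a * (1 - a) * lgp a x := by
  have := lq_ode h0 h1 (arg_lt h h')
  unfold lp1 lp2 lgp
  linear_combination this

lemma lgp_pos {a x : ℝ} (h0 : 0 < a) (h1 : a < 1) (h : -1 < x) (h' : x ≤ 1) : 0 < lgp a x := 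
  lt_of_lt_of_le one_pos (one_le_lq h0 h1 (by linarith) (by linarith))

lemma lgp_one (a : ℝ) : lgp a 1 = 1 := by
  unfold lgp lq
  rw [tsum_eq_single 0]
  · simp [lc_zero]
  · intro k hk; simp [hk]

lemma poch_le_fac {a : ℝ} (h0 : 0 < a) (h1 : a < 1) (k : ℕ) : poch a k ≤ k.factorial := by
  induction k with
  | zero => simp [poch_zero]
  | succ k ih =>
    rw [poch_succ, Nat.factorial_succ]; push_cast
    rw [mul_comm ((k:ℝ) + 1)]
    have := poch_pos h0 k
    exact mul_le_mul ih (by linarith) (by positivity) (by positivity)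

lemma lgp_le {a x : ℝ} (h0 : 0 < a) (h1 : a < 1) (h : -1 < x) (h' : x ≤ 1) : lgp a x ≤ ((1 + x) / 2) ^ (-a) := by
  have hz : |(1 - x) / 2| < 1 := arg_lt h (by linarith)
  have hb := hasSum_binom a hz
  rw [show 1 - (1 - x) / 2 = (1 + x) / 2 by ring] at hb
  rw [← hb.tsum_eq]
  refine Summable.tsum_le_tsum (fun k => ?_) ((lc_polyBd h0 h1).summable hz) hb.summable
  have hz0 : 0 ≤ (1 - x) / 2 := by linarith
  gcongr
  unfold lc
  have := poch_le_fac (show 0 < 1 - a by linarith) (by linarith) k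
  have h3 := poch_pos h0 k
  have := fac_pos k
  rw [div_le_div_iff₀ (by positivity) (by positivity)]
  calc poch a k * poch (1 - a) k * k.factorial ≤ poch a k * k.factorial * k.factorial := by gcongr
    _ = _ := by ring

lemma lgp_anti {a x y : ℝ} (h0 : 0 < a) (h1 : a < 1) (h : -1 < x) (hxy : x ≤ y) (h' : y ≤ 1) : lgp a y ≤ lgp a x := by
  refine Summable.tsum_le_tsum (fun k => ?_) ((lc_polyBd h0 h1).summable (arg_lt (by linarith) (by linarith))) ((lc_polyBd h0 h1).summable (arg_lt (by linarith) (by linarith)))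
  have := lc_pos h0 h1 k
  have hz0 : 0 ≤ (1 - y) / 2 := by linarith
  gcongr

lemma param_deriv {U : Set ℝ} (hU : IsOpen U) (F F' : ℝ → ℝ → ℝ)
    (hF : ContinuousOn (fun p : ℝ × ℝ => F p.1 p.2) (U ×ˢ Icc 0 π))
    (hF' : ContinuousOn (fun p : ℝ × ℝ => F' p.1 p.2) (U ×ˢ Icc 0 π))
    (hd : ∀ α ∈ U, ∀ φ ∈ Icc 0 π, HasDerivAt (fun α => F α φ) (F' α φ) α) {α₀ : ℝ} (h0 : α₀ ∈ U) :
    HasDerivAt (fun α => ∫ φ in (0:ℝ)..π, F α φ) (∫ φ in (0:ℝ)..π, F' α₀ φ) α₀ := by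
  obtain ⟨ε, hε, hball⟩ := Metric.isOpen_iff.1 hU α₀ h0
  have hK : Metric.closedBall α₀ (ε / 2) ⊆ U := (Metric.closedBall_subset_ball (by linarith)).trans hball
  have hcomp : IsCompact (Metric.closedBall α₀ (ε / 2) ×ˢ Icc (0:ℝ) π) := (isCompact_closedBall _ _).prod isCompact_Icc
  obtain ⟨C, hC⟩ := hcomp.exists_bound_of_continuousOn (hF'.mono (Set.prod_mono hK subset_rfl))
  have sl : ∀ G : ℝ → ℝ → ℝ, ContinuousOn (fun p : ℝ × ℝ => G p.1 p.2) (U ×ˢ Icc 0 π) → ∀ α ∈ U, 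
      ContinuousOn (G α) (Icc 0 π) := by
    intro G hG α hα
    exact hG.comp (f := fun φ => (α, φ)) (by fun_prop) (fun φ hφ => ⟨hα, hφ⟩)
  have hsub : uIoc (0:ℝ) π ⊆ Icc 0 π := by
    rw [uIoc_of_le pi_pos.le]; exact Ioc_subset_Icc_self
  have hme : ∀ G : ℝ → ℝ, ContinuousOn G (Icc 0 π) → AEStronglyMeasurable G (volume.restrict (uIoc (0:ℝ) π)) := fun G hG =>
    (hG.mono hsub).aestronglyMeasurable measurableSet_uIoc
  refine (intervalIntegral.hasDerivAt_integral_of_dominated_loc_of_deriv_le (s := Metric.ball α₀ (ε / 2)) (bound := fun _ => C)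
    (Metric.ball_mem_nhds _ (by linarith)) ?_ ?_ (hme _ (sl F' hF' _ h0)) ?_ ?_ ?_).2
  · filter_upwards [hU.mem_nhds h0] with α hα using hme _ (sl F hF _ hα)
  · apply ContinuousOn.intervalIntegrable
    rw [uIcc_of_le pi_pos.le]; exact sl F hF _ h0
  · refine Filter.Eventually.of_forall fun φ hφ α hα => ?_
    exact hC (α, φ) ⟨Metric.ball_subset_closedBall hα, hsub hφ⟩
  · simp
  · refine Filter.Eventually.of_forall fun φ hφ α hα => ?_
    exact hd α (hK (Metric.ball_subset_closedBall hα)) φ (hsub hφ)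

noncomputable def uu (b α φ : ℝ) : ℝ := Real.cos α * Real.cos b + Real.sin α * Real.sin b * Real.cos φ

lemma uu_le (b α φ : ℝ) : uu b α φ ≤ 1 := by
  unfold uu
  nlinarith [Real.sin_sq_add_cos_sq α, Real.sin_sq_add_cos_sq b, Real.sin_sq_add_cos_sq φ, sq_nonneg (Real.cos α - Real.cos b),
    sq_nonneg (Real.sin α * Real.cos φ - Real.sin b), mul_nonneg (sq_nonneg (Real.sin α)) (sq_nonneg (Real.sin φ))]

lemma uu_gt {b α φ : ℝ} (hb : 0 < b) (hα : |α| < π - b) : -1 < uu b α φ := by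
  have h1 : -1 < Real.cos (|α| + b) := by
    rw [← Real.cos_pi]
    exact Real.cos_lt_cos_of_nonneg_of_le_pi (by positivity) le_rfl (by linarith)
  rw [Real.cos_add, Real.cos_abs] at h1
  have hsb : 0 < Real.sin b := Real.sin_pos_of_pos_of_lt_pi hb (by linarith [abs_nonneg α])
  have hs : 0 ≤ Real.sin |α| := Real.sin_nonneg_of_nonneg_of_le_pi (abs_nonneg _) (by linarith)
  have h2 : |Real.sin α * Real.cos φ| ≤ Real.sin |α| := by
    rw [abs_mul]
    have : |Real.sin α| = Real.sin |α| := by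
      rcases abs_cases α with ⟨h, _⟩ | ⟨h, _⟩
      · rw [h] at hs ⊢; exact abs_of_nonneg hs
      · rw [h] at hs ⊢; rw [Real.sin_neg] at hs ⊢; rw [← abs_neg]; exact abs_of_nonneg hs
    rw [this]
    exact mul_le_of_le_one_right hs (Real.abs_cos_le_one φ)
  have h3 := (abs_le.1 h2).1
  unfold uu
  nlinarith

lemma product_open {a b α : ℝ} (h0 : 0 < a) (h1 : a < 1) (hb : 0 < b) (hα0 : 0 < α) (hα : α < π - b) :
    ∫ φ in (0:ℝ)..π, lgp a (uu b α φ) = π * lgp a (Real.cos α) * lgp a (Real.cos b) := by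
  set U : Set ℝ := {α | |α| < π - b} with hUdef
  have hU : IsOpen U := isOpen_lt continuous_abs continuous_const
  have hbπ : b < π := by linarith
  let ua : ℝ → ℝ → ℝ := fun α φ => -Real.sin α * Real.cos b + Real.cos α * Real.sin b * Real.cos φ
  have cu : Continuous (fun p : ℝ × ℝ => uu b p.1 p.2) := by unfold uu; fun_prop
  have cua : Continuous (fun p : ℝ × ℝ => ua p.1 p.2) := by simp only [ua]; fun_prop
  have hr : ∀ α ∈ U, ∀ φ, -1 < uu b α φ ∧ uu b α φ < 3 := fun α hα φ => ⟨uu_gt hb hα, by linarith [uu_le b α φ]⟩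
  have c0 : ContinuousOn (fun p : ℝ × ℝ => lgp a (uu b p.1 p.2)) (U ×ˢ Icc 0 π) := fun p hp =>
    (ContinuousAt.comp (f := fun p : ℝ × ℝ => uu b p.1 p.2) (lgp_deriv h0 h1 (hr _ hp.1 _).1 (hr _ hp.1 _).2).continuousAt cu.continuousAt).continuousWithinAt
  have c1 : ContinuousOn (fun p : ℝ × ℝ => lp1 a (uu b p.1 p.2)) (U ×ˢ Icc 0 π) := fun p hp =>
    (ContinuousAt.comp (f := fun p : ℝ × ℝ => uu b p.1 p.2) (lp1_deriv h0 h1 (hr _ hp.1 _).1 (hr _ hp.1 _).2).continuousAt cu.continuousAt).continuousWithinAt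
  have c2 : ContinuousOn (fun p : ℝ × ℝ => lp2 a (uu b p.1 p.2)) (U ×ˢ Icc 0 π) := fun p hp =>
    (ContinuousAt.comp (f := fun p : ℝ × ℝ => uu b p.1 p.2) (lp2_cont h0 h1 (hr _ hp.1 _).1 (hr _ hp.1 _).2) cu.continuousAt).continuousWithinAt
  have du : ∀ α φ, HasDerivAt (fun α => uu b α φ) (ua α φ) α := fun α φ => by
    unfold uu
    exact (((Real.hasDerivAt_cos α).mul_const _).add (((Real.hasDerivAt_sin α).mul_const _).mul_const _))
  have dua : ∀ α φ, HasDerivAt (fun α => ua α φ) (-uu b α φ) α := fun α φ => by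
    exact ((((Real.hasDerivAt_sin α).neg).mul_const _).add (((Real.hasDerivAt_cos α).mul_const _).mul_const _)).congr_deriv (by unfold uu; ring)
  let F1 : ℝ → ℝ → ℝ := fun α φ => lp1 a (uu b α φ) * ua α φ
  let F2 : ℝ → ℝ → ℝ := fun α φ => lp2 a (uu b α φ) * ua α φ * ua α φ + lp1 a (uu b α φ) * (-uu b α φ)
  have cF1 : ContinuousOn (fun p : ℝ × ℝ => F1 p.1 p.2) (U ×ˢ Icc 0 π) := c1.mul cua.continuousOn
  have cF2 : ContinuousOn (fun p : ℝ × ℝ => F2 p.1 p.2) (U ×ˢ Icc 0 π) :=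
    ((c2.mul cua.continuousOn).mul cua.continuousOn).add (c1.mul cu.neg.continuousOn)
  have D1 : ∀ α ∈ U, HasDerivAt (fun α => ∫ φ in (0:ℝ)..π, lgp a (uu b α φ)) (∫ φ in (0:ℝ)..π, F1 α φ) α := fun α hα =>
    param_deriv hU (fun α φ => lgp a (uu b α φ)) F1 c0 cF1 (fun α hα φ _ => 
      HasDerivAt.comp (h := fun α => uu b α φ) α (lgp_deriv h0 h1 (hr α hα φ).1 (hr α hα φ).2) (du α φ)) hα
  have D2 : ∀ α ∈ U, HasDerivAt (fun α => ∫ φ in (0:ℝ)..π, F1 α φ) (∫ φ in (0:ℝ)..π, F2 α φ) α := fun α hα =>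
    param_deriv hU F1 F2 cF1 cF2 (fun α hα φ _ => 
      (HasDerivAt.comp (h := fun α => uu b α φ) α (lp1_deriv h0 h1 (hr α hα φ).1 (hr α hα φ).2) (du α φ)).mul (dua α φ)) hα
  set F : ℝ → ℝ := fun α => ∫ φ in (0:ℝ)..π, lgp a (uu b α φ) with hFdef
  set G : ℝ → ℝ := fun α => ∫ φ in (0:ℝ)..π, F1 α φ with hGdef
  set H : ℝ → ℝ := fun α => ∫ φ in (0:ℝ)..π, F2 α φ with hHdef
  have sl : ∀ G : ℝ → ℝ → ℝ, ContinuousOn (fun p : ℝ × ℝ => G p.1 p.2) (U ×ˢ Icc 0 π) → ∀ α ∈ U, 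
      IntervalIntegrable (G α) volume 0 π := by
    intro G hG α hα
    apply ContinuousOn.intervalIntegrable
    rw [uIcc_of_le pi_pos.le]
    exact hG.comp (f := fun φ => (α, φ)) (by fun_prop) (fun φ hφ => ⟨hα, hφ⟩)
  -- the PDE
  have pde : ∀ α ∈ U, Real.sin α ^ 2 * H α + Real.sin α * Real.cos α * G α = a * (1 - a) * Real.sin α ^ 2 * F α := by
    intro α hα
    let V : ℝ → ℝ := fun φ => lp1 a (uu b α φ) * (-(Real.sin α * Real.sin b * Real.sin φ))
    let V' : ℝ → ℝ := fun φ => a * (1 - a) * Real.sin α ^ 2 * lgp a (uu b α φ) - (Real.sin α ^ 2 * F2 α φ + Real.sin α * Real.cos α * F1 α φ)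
    have iF := (sl (fun α φ => lgp a (uu b α φ)) c0 α hα).const_mul (a * (1 - a) * Real.sin α ^ 2)
    have iF1 := (sl F1 cF1 α hα).const_mul (Real.sin α * Real.cos α)
    have iF2 := (sl F2 cF2 α hα).const_mul (Real.sin α ^ 2)
    have hV : ∀ φ ∈ uIcc 0 π, HasDerivAt V (V' φ) φ := by
      intro φ _
      have duφ : HasDerivAt (fun φ => uu b α φ) (-(Real.sin α * Real.sin b * Real.sin φ)) φ := by
        unfold uu
        exact (((Real.hasDerivAt_cos φ).const_mul (Real.sin α * Real.sin b)).const_add _).congr_deriv (by ring)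
      have d := ((lp1_deriv h0 h1 (hr _ hα φ).1 (hr _ hα φ).2).comp φ duφ).mul
        (((Real.hasDerivAt_sin φ).const_mul (Real.sin α * Real.sin b)).neg)
      refine d.congr_deriv ?_
      have ode := lgp_ode h0 h1 (hr _ hα φ).1 (hr _ hα φ).2
      simp only [V', F1, F2, ua, Function.comp, Pi.neg_apply]
      rw [show a * (1 - a) * Real.sin α ^ 2 * lgp a (uu b α φ) = Real.sin α ^ 2 * (a * (1 - a) * lgp a (uu b α φ)) by ring, ← ode]
      have A1 : Real.cos α ^ 2 = 1 - Real.sin α ^ 2 := by linarith [Real.sin_sq_add_cos_sq α]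
      have A2 : Real.cos b ^ 2 = 1 - Real.sin b ^ 2 := by linarith [Real.sin_sq_add_cos_sq b]
      have A3 : Real.sin φ ^ 2 = 1 - Real.cos φ ^ 2 := by linarith [Real.sin_sq_add_cos_sq φ]
      generalize lp1 a (uu b α φ) = X1
      generalize lp2 a (uu b α φ) = X2
      unfold uu
      generalize Real.sin α = s at *
      generalize Real.cos α = c at *
      generalize Real.sin b = sb at *
      generalize Real.cos b = cb at *
      generalize Real.sin φ = sp at *
      generalize Real.cos φ = cp at *
      linear_combination (exp := 1) (X1 * s * sb * cp) * A1 + X2 * s ^ 2 * (A2 + sb^2 * A3 + (cb ^ 2 + sb ^ 2 * cp ^ 2) * A1)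
    have := integral_eq_sub_of_hasDerivAt hV (iF.sub (iF2.add iF1))
    rw [show V π - V 0 = 0 by simp [V]] at this
    rw [intervalIntegral.integral_sub iF (iF2.add iF1), intervalIntegral.integral_add iF2 iF1, intervalIntegral.integral_const_mul,
      intervalIntegral.integral_const_mul, intervalIntegral.integral_const_mul] at this
    linarith
  have hin : ∀ x, 0 ≤ x → x ≤ α → x ∈ U := fun x hx0 hx1 => by
    show |x| < π - b
    rw [abs_of_nonneg hx0]; linarith
  have hc : ∀ x, 0 ≤ x → x ≤ α → -1 < Real.cos x ∧ Real.cos x < 3 := fun x hx0 hx1 => by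
    refine ⟨?_, by linarith [Real.cos_le_one x]⟩
    rw [← Real.cos_pi]
    exact Real.cos_lt_cos_of_nonneg_of_le_pi hx0 le_rfl (by linarith)
  let P : ℝ → ℝ := fun x => lgp a (Real.cos x)
  let P1 : ℝ → ℝ := fun x => lp1 a (Real.cos x) * (-Real.sin x)
  let P2 : ℝ → ℝ := fun x => lp2 a (Real.cos x) * (-Real.sin x) * (-Real.sin x) + lp1 a (Real.cos x) * (-Real.cos x)
  have dP : ∀ x, 0 ≤ x → x ≤ α → HasDerivAt P (P1 x) x := fun x hx0 hx1 =>
    HasDerivAt.comp (h₂ := lgp a) (h := Real.cos) x (lgp_deriv h0 h1 (hc x hx0 hx1).1 (hc x hx0 hx1).2) (Real.hasDerivAt_cos x)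
  have dP1 : ∀ x, 0 ≤ x → x ≤ α → HasDerivAt P1 (P2 x) x := fun x hx0 hx1 =>
    (HasDerivAt.comp x (lp1_deriv h0 h1 (hc x hx0 hx1).1 (hc x hx0 hx1).2) (Real.hasDerivAt_cos x)).mul (Real.hasDerivAt_sin x).neg
  have odeP : ∀ x, 0 ≤ x → x ≤ α → Real.sin x ^ 2 * P2 x + Real.sin x * Real.cos x * P1 x = a * (1 - a) * Real.sin x ^ 2 * P x := by
    intro x hx0 hx1
    have ode := lgp_ode h0 h1 (hc x hx0 hx1).1 (hc x hx0 hx1).2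
    have A : Real.cos x ^ 2 = 1 - Real.sin x ^ 2 := by linarith [Real.sin_sq_add_cos_sq x]
    simp only [P, P1, P2]
    linear_combination (Real.sin x ^ 2) * ode + Real.sin x ^ 2 * lp2 a (Real.cos x) * A
  have hsin : ∀ x, 0 < x → x ≤ α → 0 < Real.sin x := fun x hx0 hx1 => Real.sin_pos_of_pos_of_lt_pi hx0 (by linarith)
  have hPpos : ∀ x, 0 ≤ x → x ≤ α → 0 < P x := fun x hx0 hx1 => lgp_pos h0 h1 (hc x hx0 hx1).1 (Real.cos_le_one x)
  let W : ℝ → ℝ := fun x => Real.sin x * (G x * P x - F x * P1 x)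
  let W' : ℝ → ℝ := fun x => Real.cos x * (G x * P x - F x * P1 x) + Real.sin x * ((H x * P x + G x * P1 x) - (G x * P1 x + F x * P2 x))
  have dW : ∀ x, 0 ≤ x → x ≤ α → HasDerivAt W (W' x) x := fun x hx0 hx1 =>
    (Real.hasDerivAt_sin x).mul (((D2 x (hin x hx0 hx1)).mul (dP x hx0 hx1)).sub ((D1 x (hin x hx0 hx1)).mul (dP1 x hx0 hx1)))
  have W'0 : ∀ x, 0 < x → x ≤ α → W' x = 0 := by
    intro x hx0 hx1
    have e1 := pde x (hin x hx0.le hx1)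
    have e2 := odeP x hx0.le hx1
    have : Real.sin x * W' x = 0 := by
      simp only [W']
      linear_combination P x * e1 - F x * e2
    exact (mul_eq_zero.1 this).resolve_left (hsin x hx0 hx1).ne'
  have W0 : ∀ x, 0 < x → x ≤ α → W x = 0 := by
    intro x hx0 hx1
    obtain ⟨y, hy, e⟩ := exists_hasDerivAt_eq_slope W W' hx0 (fun y hy => (dW y hy.1 (hy.2.trans hx1)).continuousAt.continuousWithinAt)
      (fun y hy => dW y hy.1.le (hy.2.le.trans hx1))
    rw [W'0 y hy.1 (hy.2.le.trans hx1), eq_comm, div_eq_zero_iff] at e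
    have w0 : W 0 = 0 := by simp [W]
    rcases e with e | e <;> linarith
  obtain ⟨y, hy, e⟩ := exists_hasDerivAt_eq_slope (fun x => F x / P x) (fun x => (G x * P x - F x * P1 x) / P x ^ 2) hα0
    (fun y hy => ((D1 y (hin y hy.1 hy.2)).div (dP y hy.1 hy.2) (hPpos y hy.1 hy.2).ne').continuousAt.continuousWithinAt)
      (fun y hy => (D1 y (hin y hy.1.le hy.2.le)).div (dP y hy.1.le hy.2.le) (hPpos y hy.1.le hy.2.le).ne')
  have hw := (mul_eq_zero.1 (W0 y hy.1 hy.2.le)).resolve_left (hsin y hy.1 hy.2.le).ne'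
  rw [hw, zero_div, eq_comm, div_eq_zero_iff] at e
  have e' : F α / P α = F 0 / P 0 := by rcases e with e | e <;> linarith
  have f0 : F 0 = π * lgp a (Real.cos b) := by simp [F, uu]
  have p0 : P 0 = 1 := by simp [P, lgp_one]
  rw [f0, p0, div_one, div_eq_iff (hPpos α hα0.le le_rfl).ne'] at e'
  rw [show (∫ φ in (0:ℝ)..π, lgp a (uu b α φ)) = F α from rfl, e']
  simp only [P]; ring

lemma one_add_cos_ge {φ : ℝ} (h0 : 0 < φ) (h1 : φ < π) : 2 / π ^ 2 * (π - φ) ^ 2 ≤ 1 + Real.cos φ := by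
  have hp := pi_pos
  have h : 1 - 2 / π * (φ / 2) ≤ Real.cos (φ / 2) := Real.one_sub_mul_le_cos (by linarith) (by linarith)
  have e : Real.cos φ = 2 * Real.cos (φ / 2) ^ 2 - 1 := by rw [← Real.cos_two_mul]; congr 1; ring
  have h2 : 1 - 2 / π * (φ / 2) = (π - φ) / π := by field_simp
  rw [h2] at h
  have h3 : ((π - φ) / π) ^ 2 ≤ Real.cos (φ / 2) ^ 2 := by
    have : 0 ≤ (π - φ) / π := div_nonneg (by linarith) hp.le
    gcongr
  rw [e]
  calc 2 / π ^ 2 * (π - φ) ^ 2 = 2 * ((π - φ) / π) ^ 2 := by field_simp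
    _ ≤ _ := by linarith

lemma lgp_bd {a k u φ : ℝ} (h0 : 0 < a) (h1 : a < 1) (hk : 0 < k) (hφ0 : 0 < φ) (hφ1 : φ < π) (hu : k * (1 + Real.cos φ) ≤ 1 + u)
    (hu1 : u ≤ 1) : -1 < u ∧ ‖lgp a u‖ ≤ (k / π ^ 2) ^ (-a) * (π - φ) ^ (-(2 * a)) := by
  have hp := pi_pos
  have hx : 0 < π - φ := by linarith
  have hc := one_add_cos_ge hφ0 hφ1
  have hc0 : 0 < 1 + Real.cos φ := lt_of_lt_of_le (by positivity) hc
  have hu' : -1 < u := by nlinarith [mul_pos hk hc0]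
  refine ⟨hu', ?_⟩
  rw [Real.norm_of_nonneg (lgp_pos h0 h1 hu' hu1).le]
  refine (lgp_le h0 h1 hu' hu1).trans ?_
  have e : (π - φ) ^ (-(2 * a)) = ((π - φ) ^ 2) ^ (-a) := by
    rw [← Real.rpow_natCast, ← Real.rpow_mul hx.le]; congr 1; push_cast; ring
  rw [e, ← Real.mul_rpow (by positivity) (by positivity)]
  refine Real.rpow_le_rpow_of_nonpos (by positivity) ?_ (by linarith)
  have := mul_le_mul_of_nonneg_left hc hk.le
  have e2 : k * (2 / π ^ 2 * (π - φ) ^ 2) = 2 * (k / π ^ 2 * (π - φ) ^ 2) := by ring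
  linarith

lemma bd_int {a : ℝ} (h1 : a < 1 / 2) (C : ℝ) : IntervalIntegrable (fun φ => C * (π - φ) ^ (-(2 * a))) volume 0 π := by
  apply IntervalIntegrable.const_mul
  have := (intervalIntegral.intervalIntegrable_rpow' (a := π) (b := 0) (r := -(2 * a)) (by linarith)).comp_sub_left π
  simpa using this

lemma uu_low {a b α φ : ℝ} (hα0 : 0 < α) (hα1 : α < π) (hb : Real.sin α / 2 ≤ Real.sin b) :
    Real.sin α ^ 2 / 2 * (1 + Real.cos φ) ≤ 1 + uu b α φ := by
  have h1 := Real.neg_one_le_cos (α + b)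
  rw [Real.cos_add] at h1
  have hs := Real.sin_pos_of_pos_of_lt_pi hα0 hα1
  have hc : 0 ≤ 1 + Real.cos φ := by linarith [Real.neg_one_le_cos φ]
  have := mul_le_mul_of_nonneg_right (mul_le_mul_of_nonneg_left hb hs.le) hc
  unfold uu
  nlinarith

lemma lgp_meas (a : ℝ) : Measurable (lgp a) := by
  unfold lgp lq
  refine Measurable.tsum (fun k => ?_)
  fun_prop

lemma product_lim {a α : ℝ} (h0 : 0 < a) (h1 : a < 1 / 2) (hα0 : 0 < α) (hα : α < π) :
    ∫ φ in (0:ℝ)..π, lgp a (uu (π - α) α φ) = π * lgp a (Real.cos α) * lgp a (-Real.cos α) := by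
  have h1' : a < 1 := by linarith
  have hs := Real.sin_pos_of_pos_of_lt_pi hα0 hα
  have hcα : -1 < -Real.cos α := by
    have : Real.cos α < 1 := by
      rw [← Real.cos_zero]; exact Real.cos_lt_cos_of_nonneg_of_le_pi le_rfl hα.le hα0
    linarith
  have hev : ∀ᶠ b in nhdsWithin (π - α) (Iio (π - α)), (Real.sin α / 2 ≤ Real.sin b) ∧ 0 < b := by
    apply nhdsWithin_le_nhds
    refine Filter.Eventually.and ?_ (lt_mem_nhds (by linarith))
    refine Filter.Tendsto.eventually_const_le (v := Real.sin (π - α)) ?_ (Real.continuous_sin.tendsto _)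
    rw [Real.sin_pi_sub]; linarith
  have T1 : Filter.Tendsto (fun b => ∫ φ in (0:ℝ)..π, lgp a (uu b α φ)) (nhdsWithin (π - α) (Iio (π - α)))
      (nhds (∫ φ in (0:ℝ)..π, lgp a (uu (π - α) α φ))) := by
    refine intervalIntegral.tendsto_integral_filter_of_dominated_convergence (fun φ => (Real.sin α ^ 2 / 2 / π ^ 2) ^ (-a) * (π - φ) ^ (-(2 * a)))
      ?_ ?_ (bd_int h1 _) ?_
    · refine Filter.Eventually.of_forall fun b => ?_
      apply Measurable.aestronglyMeasurable
      refine (lgp_meas a).comp ?_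
      unfold uu; fun_prop
    · filter_upwards [hev] with b hb
      have : ∀ᵐ φ : ℝ, φ ≠ π := by simp [ae_iff, measure_singleton]
      filter_upwards [this] with φ hφ hφ2
      rw [uIoc_of_le pi_pos.le] at hφ2
      exact (lgp_bd h0 h1' (by positivity) hφ2.1 (lt_of_le_of_ne hφ2.2 hφ) (uu_low (a := a) hα0 hα hb.1) (uu_le _ _ _)).2
    · have : ∀ᵐ φ : ℝ, φ ≠ π := by simp [ae_iff, measure_singleton]
      filter_upwards [this] with φ hφ hφ2
      rw [uIoc_of_le pi_pos.le] at hφ2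
      have hu := (lgp_bd h0 h1' (by positivity) hφ2.1 (lt_of_le_of_ne hφ2.2 hφ) (uu_low (a := a) (b := π - α) hα0 hα (by rw [Real.sin_pi_sub]; linarith)) (uu_le _ _ _)).1
      have c1 := (lgp_deriv h0 h1' hu (by linarith [uu_le (π - α) α φ])).continuousAt
      have c2 : ContinuousAt (fun b => uu b α φ) (π - α) := by unfold uu; fun_prop
      exact (ContinuousAt.comp (f := fun b => uu b α φ) c1 c2).tendsto.mono_left nhdsWithin_le_nhds
  have T2 : Filter.Tendsto (fun b => ∫ φ in (0:ℝ)..π, lgp a (uu b α φ)) (nhdsWithin (π - α) (Iio (π - α)))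
      (nhds (π * lgp a (Real.cos α) * lgp a (-Real.cos α))) := by
    have : Filter.Tendsto (fun b => π * lgp a (Real.cos α) * lgp a (Real.cos b)) (nhdsWithin (π - α) (Iio (π - α)))
      (nhds (π * lgp a (Real.cos α) * lgp a (-Real.cos α))) := by
      apply Filter.Tendsto.const_mul
      rw [← Real.cos_pi_sub] at hcα ⊢
      have c1 := (lgp_deriv h0 h1' hcα (by linarith [Real.cos_le_one (π - α)])).continuousAt
      exact (ContinuousAt.comp (f := Real.cos) c1 Real.continuous_cos.continuousAt).tendsto.mono_left nhdsWithin_le_nhds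
    refine this.congr' ?_
    filter_upwards [hev, self_mem_nhdsWithin] with b hb hb2
    have hb3 : b < π - α := hb2
    exact (product_open h0 h1' hb.2 hα0 (by linarith)).symm
  exact tendsto_nhds_unique T1 T2

lemma product_lint {a x : ℝ} (h0 : 0 < a) (h1 : a < 1 / 2) (hx0 : -1 < x) (hx1 : x < 1) :
    ∫⁻ s in Ioo (0:ℝ) 1, ENNReal.ofReal (s ^ (-1/2:ℝ) * (1 - s) ^ (-1/2:ℝ) * lgp a (2 * ((1 - x ^ 2) * s) - 1)) = 
    ENNReal.ofReal (π * lgp a x * lgp a (-x)) := by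
  have h1' : a < 1 := by linarith
  set α := Real.arccos x with hαd
  have hcos : Real.cos α = x := Real.cos_arccos hx0.le hx1.le
  have hα0 : 0 < α := Real.arccos_pos.2 hx1
  have hα1 : α < π := by
    refine lt_of_le_of_ne (Real.arccos_le_pi x) fun h => ?_
    rw [h, Real.cos_pi] at hcos; linarith
  have hs := Real.sin_pos_of_pos_of_lt_pi hα0 hα1
  have hsin : Real.sin α ^ 2 = 1 - x ^ 2 := by rw [← hcos]; linarith [Real.sin_sq_add_cos_sq α]
  have key := product_lim h0 h1 hα0 hα1
  have hbd : ∀ φ, 0 < φ → φ < π → -1 < uu (π - α) α φ ∧ ‖lgp a (uu (π - α) α φ)‖ ≤ (Real.sin α ^ 2 / 2 / π ^ 2) ^ (-a) * (π - φ) ^ (-(2 * a)) :=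
    fun φ h h' => lgp_bd h0 h1' (by positivity) h h' (uu_low (a := a) (b := π - α) hα0 hα1 (by rw [Real.sin_pi_sub]; linarith)) (uu_le _ _ _)
  have hm : Measurable (fun φ => lgp a (uu (π - α) α φ)) := by
    refine (lgp_meas a).comp ?_
    unfold uu; fun_prop
  have hint : IntegrableOn (fun φ => lgp a (uu (π - α) α φ)) (Ioo 0 π) := by
    have hb := (bd_int h1 ((Real.sin α ^ 2 / 2 / π ^ 2) ^ (-a)))
    rw [intervalIntegrable_iff_integrableOn_Ioo_of_le pi_pos.le] at hb
    refine Integrable.mono' hb hm.aestronglyMeasurable ?_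
    filter_upwards [self_mem_ae_restrict measurableSet_Ioo] with φ hφ using (hbd φ hφ.1 hφ.2).2
  rw [hcos, intervalIntegral.integral_of_le pi_pos.le, integral_Ioc_eq_integral_Ioo] at key
  rw [← key, ofReal_integral_eq_lintegral_ofReal hint ?_]
  swap
  · filter_upwards [self_mem_ae_restrict measurableSet_Ioo] with φ hφ using (lgp_pos h0 h1' (hbd φ hφ.1 hφ.2).1 (uu_le _ _ _)).le
  have hcr : ∀ φ ∈ Ioo 0 π, (1 + Real.cos φ) / 2 ∈ Ioo (0:ℝ) 1 := by
    intro φ hφ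
    have a1 : Real.cos φ < 1 := by
      rw [← Real.cos_zero]; exact Real.cos_lt_cos_of_nonneg_of_le_pi le_rfl hφ.2.le hφ.1
    have a2 : -1 < Real.cos φ := by
      rw [← Real.cos_pi]; exact Real.cos_lt_cos_of_nonneg_of_le_pi hφ.1.le le_rfl hφ.2
    constructor <;> linarith
  rw [li_subst (s := Ioo 0 π) (fun φ => (1 + Real.cos φ) / 2) (fun s => Real.arccos (2 * s - 1)) (fun φ => -Real.sin φ / 2)
    measurableSet_Ioo ?_ hcr ?_ ?_ ?_]
  · refine setLIntegral_congr_fun measurableSet_Ioo fun φ hφ => ?_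
    beta_reduce
    rw [← ENNReal.ofReal_mul (by positivity)]
    congr 1
    have hsφ := Real.sin_pos_of_pos_of_lt_pi hφ.1 hφ.2
    obtain ⟨c1, c2⟩ := hcr φ hφ
    have e1 : ((1 + Real.cos φ) / 2) ^ (-1/2:ℝ) * (1 - (1 + Real.cos φ) / 2) ^ (-1/2:ℝ) = 2 / Real.sin φ := by
      rw [← Real.mul_rpow c1.le (by linarith)]
      have : (1 + Real.cos φ) / 2 * (1 - (1 + Real.cos φ) / 2) = (Real.sin φ / 2) ^ (2:ℝ) := by
        rw [Real.rpow_two]; linear_combination (-1/4) * Real.sin_sq_add_cos_sq φ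
      rw [this, ← Real.rpow_mul (by positivity)]
      norm_num
      rw [Real.rpow_neg_one]; simp
    have e2 : 2 * ((1 - x ^ 2) * ((1 + Real.cos φ) / 2)) - 1 = uu (π - α) α φ := by
      unfold uu
      rw [Real.sin_pi_sub, Real.cos_pi_sub, hcos]
      linear_combination (-Real.cos φ) * hsin
    rw [e1, e2, abs_of_neg (by linarith)]
    field_simp
  · intro φ _
    exact ((Real.hasDerivAt_cos φ).const_add 1).div_const 2
  · intro s hs
    refine ⟨Real.arccos_pos.2 (by linarith [hs.2]), ?_⟩
    refine lt_of_le_of_ne (Real.arccos_le_pi _) fun h => ?_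
    have := Real.cos_arccos (x := 2 * s - 1) (by linarith [hs.1]) (by linarith [hs.2])
    rw [h, Real.cos_pi] at this
    linarith [hs.1]
  · intro φ hφ
    beta_reduce
    rw [show 2 * ((1 + Real.cos φ) / 2) - 1 = Real.cos φ by ring]
    exact Real.arccos_cos hφ.1.le hφ.2.le
  · intro s hs
    beta_reduce
    rw [Real.cos_arccos (by linarith [hs.1]) (by linarith [hs.2])]; ring

lemma tri_swap (f : ℝ → ℝ → ENNReal) (hf : Measurable (Function.uncurry f)) :
    ∫⁻ t in Ioo (0:ℝ) 1, ∫⁻ τ in Ioo 0 t, f t τ = ∫⁻ τ in Ioo (0:ℝ) 1, ∫⁻ t in Ioo τ 1, f t τ := by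
  have hS : MeasurableSet {p : ℝ × ℝ | 0 < p.2 ∧ p.2 < p.1 ∧ p.1 < 1} := by
    refine (measurableSet_lt measurable_const measurable_snd).inter ((measurableSet_lt measurable_snd measurable_fst).inter
      (measurableSet_lt measurable_fst measurable_const))
  have e1 : ∫⁻ t in Ioo (0:ℝ) 1, ∫⁻ τ in Ioo 0 t, f t τ = 
      ∫⁻ t, ∫⁻ τ, {p : ℝ × ℝ | 0 < p.2 ∧ p.2 < p.1 ∧ p.1 < 1}.indicator (Function.uncurry f) (t, τ) := by
    rw [← lintegral_indicator measurableSet_Ioo]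
    refine lintegral_congr fun t => ?_
    by_cases ht : t ∈ Ioo (0:ℝ) 1
    · rw [indicator_of_mem ht, ← lintegral_indicator measurableSet_Ioo]
      refine lintegral_congr fun τ => ?_
      simp only [indicator, mem_Ioo, mem_ofPred_eq, Function.uncurry]
      congr 1
      simp [ht.2]
    · rw [indicator_of_notMem ht]
      rw [show (0:ENNReal) = ∫⁻ τ : ℝ, 0 by simp]
      refine lintegral_congr fun τ => ?_
      rw [indicator_of_notMem]
      rintro ⟨h1, h2, h3⟩
      exact ht ⟨h1.trans h2, h3⟩
  have e2 : ∫⁻ τ in Ioo (0:ℝ) 1, ∫⁻ t in Ioo τ 1, f t τ = 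
      ∫⁻ τ, ∫⁻ t, {p : ℝ × ℝ | 0 < p.2 ∧ p.2 < p.1 ∧ p.1 < 1}.indicator (Function.uncurry f) (t, τ) := by
    rw [← lintegral_indicator measurableSet_Ioo]
    refine lintegral_congr fun τ => ?_
    by_cases ht : τ ∈ Ioo (0:ℝ) 1
    · rw [indicator_of_mem ht, ← lintegral_indicator measurableSet_Ioo]
      refine lintegral_congr fun t => ?_
      simp only [indicator, mem_Ioo, mem_ofPred_eq, Function.uncurry]
      congr 1
      simp [ht.1]
    · rw [indicator_of_notMem ht]
      rw [show (0:ENNReal) = ∫⁻ τ : ℝ, 0 by simp]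
      refine lintegral_congr fun t => ?_
      rw [indicator_of_notMem]
      rintro ⟨h1, h2, h3⟩
      exact ht ⟨h1, by simp only at h1 h2 h3; linarith⟩
  rw [e1, e2]
  exact lintegral_lintegral_swap (hf.indicator hS).aemeasurable

/-- inner Beta integral -/
lemma inner_beta {σ m : ℝ} (hσ0 : 0 < σ) (hσ : σ < 1 / 2) (hm0 : 0 < m) (hm1 : m < 1) :
    ∫⁻ κ in Ioo m 1, ENNReal.ofReal ((1 - κ) ^ (-1/2:ℝ) * (κ - m) ^ (-σ-1/2:ℝ)) = 
      ENNReal.ofReal ((1 - m) ^ (-σ)) * ENNReal.ofReal (Real.Gamma (1/2-σ) * Real.Gamma (1/2) / Real.Gamma (1 - σ)) := by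
  have h1 : 0 < 1 - m := by linarith
  have hb := li_beta (α := 1/2-σ) (β := 1/2) (by linarith) (by norm_num)
  rw [show 1/2 - σ + 1/2 = 1 - σ by ring] at hb
  rw [← hb, ← lintegral_const_mul' _ _ ENNReal.ofReal_ne_top]
  rw [li_subst (s := Ioo 0 1) (fun y => m + (1 - m) * y) (fun κ => (κ - m) / (1 - m)) (fun _ => 1 - m) measurableSet_Ioo]
  · refine setLIntegral_congr_fun measurableSet_Ioo fun y hy => ?_
    beta_reduce
    rw [← ENNReal.ofReal_mul (by positivity), ← ENNReal.ofReal_mul (by positivity)]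
    congr 1
    have hy1 : 0 < 1 - y := by linarith [hy.2]
    rw [abs_of_pos h1, show 1 - (m + (1 - m) * y) = (1 - m) * (1 - y) by ring, show m + (1 - m) * y - m = (1 - m) * y by ring,
      Real.mul_rpow h1.le hy1.le, Real.mul_rpow h1.le hy.1.le]
    have : (1 - m) * ((1 - m) ^ (-1/2:ℝ) * (1 - m) ^ (-σ-1/2:ℝ)) = (1 - m) ^ (-σ) := by
      rw [← Real.rpow_add h1]
      nth_rw 1 [← Real.rpow_one (1 - m)]
      rw [← Real.rpow_add h1]; congr 1; ring
    rw [← this, show (1/2:ℝ) - 1 = -1/2 by norm_num, show 1/2 - σ - 1 = -σ-1/2 by ring]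
    ring
  · intro y _
    exact (((hasDerivAt_id' y).const_mul (1 - m)).const_add m).congr_deriv (by ring)
  · intro y hy
    constructor
    · nlinarith [mul_pos h1 hy.1]
    · nlinarith [mul_pos h1 (sub_pos.2 hy.2)]
  · intro κ hκ
    constructor
    · exact div_pos (by linarith [hκ.1]) h1
    · rw [div_lt_one h1]; linarith [hκ.2]
  · intro y _; beta_reduce; field_simp; ring
  · intro κ _; beta_reduce; field_simp; ring

lemma collapse {σ η : ℝ} (hσ0 : 0 < σ) (hσ : σ < 1 / 2) (hη : 0 < η) :
    ∫⁻ κ in Ioo (0:ℝ) 1, ∫⁻ q in Ioo (0:ℝ) 1, 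
      ENNReal.ofReal (κ ^ (-1/2:ℝ) * (1 - κ) ^ (-1/2:ℝ) * (q ^ (-σ-1/2) * (1 - q) ^ (σ - 1) * (1 + (1 - q) * κ * η) ^ (-σ))) = 
    ENNReal.ofReal (Real.Gamma (1/2-σ) * Real.Gamma (1/2) / Real.Gamma (1 - σ)) * KA σ η := by
  let f : ℝ → ℝ → ENNReal := fun κ m => ENNReal.ofReal (((1 - κ) ^ (-1/2:ℝ) * (κ - m) ^ (-σ-1/2:ℝ)) * (m ^ (σ - 1) * (1 + m * η) ^ (-σ)))
  have e1 : ∀ κ ∈ Ioo (0:ℝ) 1, ∫⁻ q in Ioo (0:ℝ) 1, 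
      ENNReal.ofReal (κ ^ (-1/2:ℝ) * (1 - κ) ^ (-1/2:ℝ) * (q ^ (-σ-1/2) * (1 - q) ^ (σ - 1) * (1 + (1 - q) * κ * η) ^ (-σ))) =
      ∫⁻ m in Ioo 0 κ, f κ m := by
    intro κ hκ
    obtain ⟨hκ0, hκ1⟩ := hκ
    rw [li_subst (s := Ioo 0 κ) (fun m => 1 - m / κ) (fun q => (1 - q) * κ) (fun _ => -(1 / κ)) measurableSet_Ioo]
    · refine setLIntegral_congr_fun measurableSet_Ioo fun m hm => ?_
      obtain ⟨hm0, hm1⟩ := hm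
      simp only [f]
      rw [← ENNReal.ofReal_mul (by positivity)]
      congr 1
      have hs : 0 < κ - m := by linarith
      rw [abs_neg, abs_of_pos (by positivity), show 1 - (1 - m / κ) = m / κ by ring, show 1 - m / κ = (κ - m) / κ by field_simp,
        show m / κ * κ = m by field_simp, Real.div_rpow hs.le hκ0.le, Real.div_rpow hm0.le hκ0.le]
      have : 1 / κ * (κ ^ (-1/2:ℝ) * ((κ ^ (-σ-1/2:ℝ))⁻¹ * (κ ^ (σ-1))⁻¹)) = 1 := by
        rw [← Real.rpow_neg hκ0.le, ← Real.rpow_neg hκ0.le, ← Real.rpow_add hκ0, ← Real.rpow_add hκ0]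
        rw [show -1/2 + (-(-σ-1/2) + -(σ-1)) = (1:ℝ) by ring, Real.rpow_one]; field_simp
      linear_combination ((1 - κ) ^ (-1/2:ℝ) * (κ - m) ^ (-σ-1/2:ℝ)) * (m ^ (σ - 1) * (1 + m * η) ^ (-σ)) * this
    · intro m _
      exact (((hasDerivAt_id' m).div_const κ).const_sub 1)
    · intro m hm
      have h1 : 0 < m / κ := div_pos hm.1 hκ0
      have h2 : m / κ < 1 := by rw [div_lt_one hκ0]; exact hm.2
      constructor <;> linarith
    · intro q hq
      constructor
      · exact mul_pos (by linarith [hq.2]) hκ0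
      · nlinarith [hq.1]
    · intro m _; beta_reduce; field_simp; ring
    · intro q _; beta_reduce; field_simp; ring
  rw [setLIntegral_congr_fun measurableSet_Ioo e1, tri_swap f (by simp only [f, Function.uncurry_def]; fun_prop)]
  unfold KA
  rw [← lintegral_const_mul' _ _ ENNReal.ofReal_ne_top]
  refine setLIntegral_congr_fun measurableSet_Ioo fun m hm => ?_
  obtain ⟨hm0, hm1⟩ := hm
  have hm2 : 0 < 1 - m := by linarith
  simp only [f]
  have : ∫⁻ κ in Ioo m 1, ENNReal.ofReal ((1 - κ) ^ (-1/2:ℝ) * (κ - m) ^ (-σ-1/2:ℝ) * (m ^ (σ - 1) * (1 + m * η) ^ (-σ))) = 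
     (∫⁻ κ in Ioo m 1, ENNReal.ofReal ((1 - κ) ^ (-1/2:ℝ) * (κ - m) ^ (-σ-1/2:ℝ))) * ENNReal.ofReal (m ^ (σ - 1) * (1 + m * η) ^ (-σ)) := by
    rw [← lintegral_mul_const' _ _ ENNReal.ofReal_ne_top]
    refine setLIntegral_congr_fun measurableSet_Ioo fun κ hκ => ?_
    beta_reduce
    rw [← ENNReal.ofReal_mul]
    exact mul_nonneg (Real.rpow_nonneg (by linarith [hκ.2]) _) (Real.rpow_nonneg (by linarith [hκ.1]) _)
  rw [this, inner_beta hσ0 hσ hm0 hm1, mul_right_comm, mul_comm, ← ENNReal.ofReal_mul (by positivity)]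
  congr 2
  ring

noncomputable def EE (σ t : ℝ) : ENNReal :=
  ∫⁻ q in Ioo (0:ℝ) 1, ENNReal.ofReal (q ^ (-σ - 1 / 2) * (1 - q) ^ (σ - 1) * (1 - q * (1 - t)) ^ (-σ))

lemma EE_meas (σ : ℝ) : Measurable (EE σ) := by
  unfold EE
  refine Measurable.lintegral_prod_right' (f := fun p : ℝ × ℝ => ENNReal.ofReal (p.2 ^ (-σ - 1 / 2) * (1 - p.2) ^ (σ - 1) * (1 - p.2 * (1 - p.1)) ^ (-σ))) ?_
  fun_prop

lemma inner2 {σ τ : ℝ} (hτ0 : 0 < τ) (hτ1 : τ < 1) :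
    ∫⁻ t in Ioo τ 1, ENNReal.ofReal (t ^ (σ - 1) * (1 - t) ^ (-1/2:ℝ) * (t - τ) ^ (-1/2:ℝ)) * EE σ t = 
    ENNReal.ofReal (τ ^ (-1/2:ℝ)) * ∫⁻ κ in Ioo (0:ℝ) 1, ∫⁻ q in Ioo (0:ℝ) 1, 
      ENNReal.ofReal (κ ^ (-1/2:ℝ) * (1 - κ) ^ (-1/2:ℝ) * (q ^ (-σ-1/2) * (1 - q) ^ (σ - 1) * (1 + (1 - q) * κ * ((1 - τ) / τ)) ^ (-σ))) := by
  obtain ⟨η, hη⟩ : ∃ η, η = (1 - τ) / τ := ⟨_, rfl⟩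
  have hτ2 : 0 < 1 - τ := by linarith
  have hη0 : 0 < η := by rw [hη]; positivity
  have hτη : τ = 1 / (1 + η) := by rw [hη]; field_simp; ring
  rw [← hη, ← lintegral_const_mul' _ _ ENNReal.ofReal_ne_top]
  rw [li_subst (s := Ioo 0 1) (fun κ => 1 / (1 + κ * η)) (fun t => (1 / t - 1) / η) (fun κ => -η / (1 + κ * η) ^ 2) measurableSet_Ioo]
  · refine setLIntegral_congr_fun measurableSet_Ioo fun κ hκ => ?_
    obtain ⟨hκ0, hκ1⟩ := hκ
    have hκ2 : 0 < 1 - κ := by linarith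
    have hw : 0 < 1 + κ * η := by positivity
    beta_reduce
    unfold EE
    rw [← mul_assoc, ← ENNReal.ofReal_mul (by positivity), ← lintegral_const_mul' _ _ ENNReal.ofReal_ne_top, 
      ← lintegral_const_mul' _ _ ENNReal.ofReal_ne_top]
    refine setLIntegral_congr_fun measurableSet_Ioo fun q hq => ?_
    obtain ⟨hq0, hq1⟩ := hq
    have hq2 : 0 < 1 - q := by linarith
    beta_reduce
    have e1 : 1 - 1 / (1 + κ * η) = κ * η / (1 + κ * η) := by field_simp; ring
    have e2 : 1 / (1 + κ * η) - τ = τ * (1 - κ) * η / (1 + κ * η) := by rw [hτη]; field_simp; ring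
    have e3 : 1 - q * (κ * η / (1 + κ * η)) = (1 + (1 - q) * κ * η) / (1 + κ * η) := by field_simp; ring
    rw [e1, e2, e3]
    rw [← ENNReal.ofReal_mul, ← ENNReal.ofReal_mul (by positivity)]
    swap
    · have : 0 < κ * η / (1 + κ * η) := by positivity
      have : 0 < τ * (1 - κ) * η / (1 + κ * η) := by positivity
      positivity
    congr 1
    have hv : 0 < 1 + (1 - q) * κ * η := by positivity
    rw [abs_of_neg (by rw [neg_div]; exact neg_neg_of_pos (by positivity)), Real.div_rpow zero_le_one hw.le, Real.one_rpow, Real.div_rpow (by positivity) hw.le, Real.div_rpow (by positivity) hw.le, Real.div_rpow hv.le hw.le,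
      Real.mul_rpow hκ0.le hη0.le, Real.mul_rpow (by positivity) hη0.le, Real.mul_rpow hτ0.le hκ2.le]
    generalize 1 + κ * η = w at *
    have p1 : ((w ^ (σ - 1))⁻¹ * (w ^ (-1/2:ℝ))⁻¹ * (w ^ (-1/2:ℝ))⁻¹ * (w ^ (-σ))⁻¹) = w ^ 2 := by
      rw [← Real.rpow_neg hw.le, ← Real.rpow_neg hw.le, ← Real.rpow_neg hw.le, ← Real.rpow_add hw, ← Real.rpow_add hw, ← Real.rpow_add hw,
        ← Real.rpow_natCast]
      congr 1; push_cast; ring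
    have p2 : η * (η ^ (-1/2:ℝ) * η ^ (-1/2:ℝ)) = 1 := by
      rw [← Real.rpow_add hη0, show (-1/2 + -1/2 : ℝ) = -1 by norm_num, Real.rpow_neg_one]; field_simp
    have p3 : η * ((w ^ 2)⁻¹) * ((w ^ (σ - 1))⁻¹ * (w ^ (-1/2:ℝ))⁻¹ * (w ^ (-1/2:ℝ))⁻¹ * (w ^ (-σ))⁻¹) * (η ^ (-1/2:ℝ) * η ^ (-1/2:ℝ)) = 1 := by
      rw [p1, mul_assoc η, inv_mul_cancel₀ (by positivity), mul_one]; exact p2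
    generalize hX : 1 + (1 - q) * κ * η = X at *
    linear_combination (τ ^ (-1/2:ℝ) * (κ ^ (-1/2:ℝ) * (1 - κ) ^ (-1/2:ℝ)* (q ^ (-σ-1/2) * (1 - q) ^ (σ - 1) * X ^ (-σ)))) * p3
  · intro κ hκ
    have hw : 0 < 1 + κ * η := by have := hκ.1; positivity
    have := (((hasDerivAt_id' κ).mul_const η).const_add 1).inv hw.ne'
    simp only [one_div]
    exact this.congr_deriv (by ring)
  · intro κ hκ
    obtain ⟨hκ0, hκ1⟩ := hκ
    have hw : 0 < 1 + κ * η := by positivity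
    constructor
    · rw [hτη]; apply one_div_lt_one_div_of_lt hw; nlinarith
    · rw [div_lt_one hw]; nlinarith [mul_pos hκ0 hη0]
  · intro t ht
    have ht0 : 0 < t := hτ0.trans ht.1
    have h1 : 1 < 1 / t := by rw [lt_div_iff₀ ht0]; linarith [ht.2]
    have h2 : 1 / t < 1 + η := by
      have h3 : (1 + η) * τ = 1 := by rw [hτη]; field_simp
      rw [div_lt_iff₀ ht0]; nlinarith [ht.1]
    constructor
    · exact div_pos (by linarith) hη0
    · rw [div_lt_one hη0]; linarith
  · intro κ hκ
    have hw : 0 < 1 + κ * η := by have := hκ.1; positivity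
    beta_reduce; field_simp; ring
  · intro t ht
    have ht0 : 0 < t := hτ0.trans ht.1
    beta_reduce
    rw [div_mul_cancel₀ _ hη0.ne']; field_simp; ring

lemma s_to_tau {t : ℝ} (ht0 : 0 < t) (g : ℝ → ℝ) :
    ∫⁻ s in Ioo (0:ℝ) 1, ENNReal.ofReal (s ^ (-1/2:ℝ) * (1 - s) ^ (-1/2:ℝ) * g (t * s)) = 
    ∫⁻ τ in Ioo (0:ℝ) t, ENNReal.ofReal (τ ^ (-1/2:ℝ) * (t - τ) ^ (-1/2:ℝ) * g τ) := by
  rw [li_subst (t := Ioo 0 t) (s := Ioo 0 1) (fun s => t * s) (fun τ => τ / t) (fun _ => t) measurableSet_Ioo]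
  · refine setLIntegral_congr_fun measurableSet_Ioo fun s hs => ?_
    beta_reduce
    rw [← ENNReal.ofReal_mul (by positivity)]
    congr 1
    have hs2 : 0 < 1 - s := by linarith [hs.2]
    rw [abs_of_pos ht0, show t - t * s = t * (1 - s) by ring, Real.mul_rpow ht0.le hs.1.le, Real.mul_rpow ht0.le hs2.le]
    have p2 : t * (t ^ (-1/2:ℝ) * t ^ (-1/2:ℝ)) = 1 := by
      rw [← Real.rpow_add ht0, show (-1/2 + -1/2 : ℝ) = -1 by norm_num, Real.rpow_neg_one]; field_simp
    generalize g (t * s) = y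
    linear_combination (-(s ^ (-1/2:ℝ) * (1 - s) ^ (-1/2:ℝ) * y)) * p2
  · intro y _
    exact ((hasDerivAt_id' y).const_mul t).congr_deriv (by ring)
  · intro y hy
    constructor
    · exact mul_pos ht0 hy.1
    · nlinarith [hy.2]
  · intro κ hκ
    constructor
    · exact div_pos hκ.1 ht0
    · rw [div_lt_one ht0]; exact hκ.2
  · intro y _; beta_reduce; field_simp
  · intro κ _; beta_reduce; field_simp

lemma fold_even (f : ℝ → ENNReal) (hf : Measurable f) : ∫⁻ x in Ioo (-1:ℝ) 1, f x = ∫⁻ x in Ioo (0:ℝ) 1, (f x + f (-x)) := by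
  rw [lintegral_add_left hf]
  have e : ∫⁻ x in Ioo (0:ℝ) 1, f (-x) = ∫⁻ x in Ioo (-1:ℝ) 0, f x := by
    rw [li_subst (s := Ioo 0 1) (t := Ioo (-1) 0) (fun s => -s) (fun s => -s) (fun _ => -1) measurableSet_Ioo]
    · simp
    · intro y _; exact (hasDerivAt_id' y).neg
    · intro y hy; constructor <;> linarith [hy.1, hy.2]
    · intro y hy; constructor <;> linarith [hy.1, hy.2]
    · simp
    · simp
  rw [e, add_comm, ← setLIntegral_congr (Ioo_ae_eq_Ico (a := (0:ℝ)) (b := 1)).symm, ← lintegral_union measurableSet_Ico]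
  · rw [Ioo_union_Ico_eq_Ioo (by norm_num) (by norm_num)]
  · rw [Set.disjoint_left]; intro x hx hx2; linarith [hx.2, hx2.1]

lemma x_to_t (f : ℝ → ENNReal) : ∫⁻ x in Ioo (0:ℝ) 1, f x = ∫⁻ t in Ioo (0:ℝ) 1, ENNReal.ofReal (1 / 2 * (1 - t) ^ (-1/2:ℝ)) * f (√(1 - t)) := by
  rw [li_subst (s := Ioo 0 1) (t := Ioo 0 1) (fun t => √(1 - t)) (fun x => 1 - x ^ 2) (fun t => -1 / (2 * √(1 - t))) measurableSet_Ioo]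
  · refine setLIntegral_congr_fun measurableSet_Ioo fun t ht => ?_
    beta_reduce
    congr 2
    have h : 0 < 1 - t := by linarith [ht.2]
    rw [neg_div, abs_neg, abs_of_pos (by positivity), show (-1/2:ℝ) = -(1/2) by norm_num, Real.rpow_neg h.le, Real.sqrt_eq_rpow]
    field_simp
  · intro t ht
    have h : 0 < 1 - t := by linarith [ht.2]
    exact ((hasDerivAt_id' t).const_sub 1).sqrt h.ne'
  · intro t ht
    refine ⟨Real.sqrt_pos.2 (by linarith [ht.2]), ?_⟩
    rw [Real.sqrt_lt' one_pos]; linarith [ht.1]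
  · intro x hx
    constructor <;> nlinarith [hx.1, hx.2]
  · intro t ht
    beta_reduce
    rw [Real.sq_sqrt (by linarith [ht.2])]; ring
  · intro x hx
    beta_reduce
    rw [show 1 - (1 - x ^ 2) = x ^ 2 by ring]; exact Real.sqrt_sq hx.1.le

noncomputable def C2 (σ : ℝ) : ℝ := 2 ^ (1 - 2 * σ) * √π / (Real.Gamma (1 - 2 * σ) * Real.Gamma (σ + 1 / 2) * Real.Gamma σ)
noncomputable def CB (σ : ℝ) : ℝ := Real.Gamma (1/2-σ) * Real.Gamma (1/2) / Real.Gamma (1 - σ)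

lemma J_step1 {σ : ℝ} (h0 : 0 < σ) (h1 : σ < 1 / 4) :
    ∫⁻ x in Ioo (-1:ℝ) 1, ENNReal.ofReal (lgp (2 * σ) x ^ 2 * lgp (2 * σ) (-x) * (1 - x ^ 2) ^ (σ - 1)) = 
    ENNReal.ofReal (C2 σ / (2 * π)) * ∫⁻ t in Ioo (0:ℝ) 1, ∫⁻ τ in Ioo (0:ℝ) t, 
      ENNReal.ofReal (t ^ (σ - 1) * (1 - t) ^ (-1/2:ℝ) * (t - τ) ^ (-1/2:ℝ)) * EE σ t * ENNReal.ofReal (τ ^ (-1/2:ℝ) * lgp (2 * σ) (2 * τ - 1)) := by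
  have hm := lgp_meas (2 * σ)
  have hp := pi_pos
  have hC : 0 < C2 σ := by
    have g1 := Real.Gamma_pos_of_pos h0
    have g2 := Real.Gamma_pos_of_pos (show 0 < 1 - 2 * σ by linarith)
    have g3 := Real.Gamma_pos_of_pos (show 0 < σ + 1 / 2 by linarith)
    unfold C2; positivity
  rw [fold_even _ (by fun_prop), x_to_t, ← lintegral_const_mul' _ _ ENNReal.ofReal_ne_top]
  refine setLIntegral_congr_fun measurableSet_Ioo fun t ht => ?_
  obtain ⟨ht0, ht1⟩ := ht
  have ht2 : 0 < 1 - t := by linarith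
  set x := √(1 - t) with hx
  have hx0 : 0 < x := Real.sqrt_pos.2 ht2
  have hxx : x ^ 2 = 1 - t := Real.sq_sqrt ht2.le
  have hx1 : x < 1 := by rw [hx, Real.sqrt_lt' one_pos]; linarith
  have q1 := lgp_pos (a := 2 * σ) (by linarith) (by linarith) (show -1 < x by linarith) hx1.le
  have q2 := lgp_pos (a := 2 * σ) (by linarith) (by linarith) (show -1 < -x by linarith) (by linarith)
  have f2 := F2 h0 (by linarith) (show -1 < x by linarith) hx1
  rw [hxx] at f2
  have f3 := product_lint (a := 2 * σ) (by linarith) (by linarith) (show -1 < x by linarith) hx1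
  rw [hxx, show 1 - (1 - t) = t by ring, s_to_tau ht0 (fun τ => lgp (2 * σ) (2 * τ - 1))] at f3
  beta_reduce
  have e : ∀ τ ∈ Ioo 0 t, ENNReal.ofReal (t ^ (σ - 1) * (1 - t) ^ (-1/2:ℝ) * (t - τ) ^ (-1/2:ℝ)) * EE σ t * ENNReal.ofReal (τ ^ (-1/2:ℝ) * lgp (2 * σ) (2 * τ - 1))
     = (ENNReal.ofReal (t ^ (σ - 1) * (1 - t) ^ (-1/2:ℝ)) * EE σ t) * ENNReal.ofReal (τ ^ (-1/2:ℝ) * (t - τ) ^ (-1/2:ℝ) * lgp (2 * σ) (2 * τ - 1)) := by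
    intro τ hτ
    have h3 : 0 < t - τ := by linarith [hτ.2]
    rw [ENNReal.ofReal_mul (p := t ^ (σ - 1) * (1 - t) ^ (-1/2:ℝ)) (by positivity), show τ ^ (-1/2:ℝ) * (t - τ) ^ (-1/2:ℝ) * lgp (2 * σ) (2 * τ - 1) = (t - τ) ^ (-1/2:ℝ) * (τ ^ (-1/2:ℝ) * lgp (2 * σ) (2 * τ - 1)) by ring,
      ENNReal.ofReal_mul (p := (t - τ) ^ (-1/2:ℝ)) (by positivity)]
    ring
  rw [setLIntegral_congr_fun measurableSet_Ioo e, lintegral_const_mul _ (by fun_prop), f3]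
  unfold EE
  change ENNReal.ofReal (C2 σ) * _ = _ at f2
  rw [show C2 σ / (2 * π) = (1 / (2 * π)) * C2 σ by ring, ENNReal.ofReal_mul (p := 1 / (2 * π)) (by positivity)]
  have : ∀ a b c d e : ENNReal, a * b * (c * d * e) = a * c * e * (b * d) := fun a b c d e => by ring
  rw [this, f2, ← ENNReal.ofReal_mul (by positivity), ← ENNReal.ofReal_mul (by positivity), ← ENNReal.ofReal_mul (by positivity)]
  rw [neg_neg, show (-x) ^ 2 = x ^ 2 by ring, hxx, show 1 - (1 - t) = t by ring, ← ENNReal.ofReal_add (by positivity) (by positivity), ← ENNReal.ofReal_mul (by positivity)]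
  congr 1
  field_simp

lemma J_step2 {σ : ℝ} (h0 : 0 < σ) (h1 : σ < 1 / 4) :
    ∫⁻ x in Ioo (-1:ℝ) 1, ENNReal.ofReal (lgp (2 * σ) x ^ 2 * lgp (2 * σ) (-x) * (1 - x ^ 2) ^ (σ - 1)) = 
    ENNReal.ofReal (C2 σ / (2 * π)) * (ENNReal.ofReal (CB σ) * ∫⁻ τ in Ioo (0:ℝ) 1, ENNReal.ofReal (τ ⁻¹ * lgp (2 * σ) (2 * τ - 1)) * KA σ ((1 - τ) / τ)) := by
  have hm := lgp_meas (2 * σ)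
  rw [J_step1 h0 h1, tri_swap]
  swap
  · have := EE_meas σ
    simp only [Function.uncurry_def]; fun_prop
  congr 1
  rw [← lintegral_const_mul' _ _ ENNReal.ofReal_ne_top]
  refine setLIntegral_congr_fun measurableSet_Ioo fun τ hτ => ?_
  obtain ⟨h3, h4⟩ := hτ
  have h5 : 0 < 1 - τ := by linarith
  beta_reduce
  rw [lintegral_mul_const' _ _ ENNReal.ofReal_ne_top, inner2 h3 h4, collapse h0 (by linarith) (by positivity)]
  change _ * (ENNReal.ofReal (CB σ) * _) * _ = _
  have : ∀ a b c d : ENNReal, a * (b * c) * d = b * (a * d * c) := fun a b c d => by ring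
  rw [this, ← ENNReal.ofReal_mul (by positivity), ← mul_assoc (τ ^ _), ← Real.rpow_add h3, show (-1/2 + -1/2:ℝ) = -1 by norm_num, Real.rpow_neg_one]

lemma J_step3 {σ : ℝ} (h0 : 0 < σ) (h1 : σ < 1 / 4) :
    ∫⁻ τ in Ioo (0:ℝ) 1, ENNReal.ofReal (τ ⁻¹ * lgp (2 * σ) (2 * τ - 1)) * KA σ ((1 - τ) / τ) = 
    ENNReal.ofReal (1 / (Real.Gamma (2 * σ) * Real.Gamma (1 - 2 * σ))) * ∫⁻ η in Ioi (0:ℝ), KA (2 * σ) η * KA (1 - σ) η := by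
  have g1 := Real.Gamma_pos_of_pos (show 0 < 2 * σ by linarith)
  have g2 := Real.Gamma_pos_of_pos (show 0 < 1 - 2 * σ by linarith)
  rw [li_subst (s := Ioi 0) (fun η => 1 / (1 + η)) (fun τ => (1 - τ) / τ) (fun η => -1 / (1 + η) ^ 2) measurableSet_Ioi, 
    ← lintegral_const_mul' _ _ ENNReal.ofReal_ne_top]
  · refine setLIntegral_congr_fun measurableSet_Ioi fun η hη => ?_
    have hη : (0:ℝ) < η := hη
    have hw : 0 < 1 + η := by linarith
    beta_reduce
    rw [show (1 - 1 / (1 + η)) / (1 / (1 + η)) = η by field_simp; ring, KA_euler h0 (by linarith) hη, KA_lq (a := 2 * σ) (by linarith) (by linarith) hη]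
    have e : lgp (2 * σ) (2 * (1 / (1 + η)) - 1) = lq (2 * σ) (η / (1 + η)) := by
      unfold lgp; congr 1; field_simp; ring
    have hl := one_le_lq (a := 2 * σ) (z := η / (1 + η)) (by linarith) (by linarith) (by positivity) (by rw [div_lt_one hw]; linarith)
    rw [e]
    generalize lq (2 * σ) (η / (1 + η)) = y at *
    have hy : 0 < y := by linarith
    rw [← mul_assoc, ← mul_assoc, ← mul_assoc, ← ENNReal.ofReal_mul (by positivity), ← ENNReal.ofReal_mul (by positivity), ← ENNReal.ofReal_mul (by positivity)]
    congr 2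
    rw [neg_div, abs_neg, abs_of_pos (by positivity), Real.rpow_sub hw, Real.rpow_neg hw.le, Real.rpow_one]
    field_simp
  · intro η hη
    have hη : (0:ℝ) < η := hη
    have hw : 0 < 1 + η := by linarith
    have := (((hasDerivAt_id' η)).const_add 1).inv hw.ne'
    simp only [one_div]
    exact this
  · intro η hη
    have hη : (0:ℝ) < η := hη
    have hw : 0 < 1 + η := by linarith
    exact ⟨by positivity, by rw [div_lt_one hw]; linarith⟩
  · intro τ hτ
    exact div_pos (by linarith [hτ.2]) hτ.1
  · intro η hη
    have hη : (0:ℝ) < η := hη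
    beta_reduce; field_simp; ring
  · intro τ hτ
    have := hτ.1
    beta_reduce; field_simp; ring

lemma J_final {σ : ℝ} (h0 : 0 < σ) (h1 : σ < 1 / 4) :
    ∫⁻ x in Ioo (-1:ℝ) 1, ENNReal.ofReal (lgp (2 * σ) x ^ 2 * lgp (2 * σ) (-x) * (1 - x ^ 2) ^ (σ - 1)) = 
    ENNReal.ofReal ((1 / π) * (Real.sin (π * σ) / 2 ^ (2 * σ - 1)) ^ 3 * (Real.Gamma σ / Real.Gamma (σ + 1 / 2)) ^ 4) := by
  have hp := pi_pos
  have g1 := Real.Gamma_pos_of_pos (show 0 < 2 * σ by linarith)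
  have g2 := Real.Gamma_pos_of_pos (show 0 < 1 - 2 * σ by linarith)
  have g3 := Real.Gamma_pos_of_pos h0
  have g4 := Real.Gamma_pos_of_pos (show 0 < σ + 1 / 2 by linarith)
  have g5 := Real.Gamma_pos_of_pos (show 0 < 1 - σ by linarith)
  have g6 := Real.Gamma_pos_of_pos (show 0 < 1 / 2 - σ by linarith)
  have d1 := Real.Gamma_mul_Gamma_add_half σ
  have d2 := Real.Gamma_mul_Gamma_add_half (1 / 2 - σ)
  rw [show 1 / 2 - σ + 1 / 2 = 1 - σ by ring, show 2 * (1 / 2 - σ) = 1 - 2 * σ by ring, show 1 - (1 - 2 * σ) = 2 * σ by ring] at d2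
  have d3 := Real.Gamma_mul_Gamma_one_sub σ
  have hs : 0 < Real.sin (π * σ) := Real.sin_pos_of_pos_of_lt_pi (by positivity) (by nlinarith)
  have d3' : Real.sin (π * σ) = π / (Real.Gamma σ * Real.Gamma (1 - σ)) := by rw [d3]; field_simp
  rw [J_step2 h0 h1, J_step3 h0 h1, Q_lemma (by linarith) (by linarith) (by linarith) (by linarith) (by linarith)]
  have hCB : 0 < CB σ := by unfold CB; rw [Real.Gamma_one_half_eq]; positivity
  have hC2 : 0 < C2 σ := by unfold C2; positivity
  rw [← ENNReal.ofReal_mul (by positivity), ← ENNReal.ofReal_mul (by positivity), ← ENNReal.ofReal_mul (by positivity)]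
  congr 1
  unfold CB C2
  rw [d3', Real.Gamma_one_half_eq, show 1 - (1 - σ) = σ by ring, show 2 * σ + (1 - σ) - 1 = σ by ring]
  have k1 : (2:ℝ) ^ (2 * σ - 1) = 2 ^ (2 * σ) / 2 := by rw [Real.rpow_sub two_pos, Real.rpow_one]
  have k2 : (2:ℝ) ^ (1 - 2 * σ) = 2 / 2 ^ (2 * σ) := by rw [Real.rpow_sub two_pos, Real.rpow_one]
  rw [k2] at d1
  rw [k1, k2]
  have hpow : (0:ℝ) < 2 ^ (2 * σ) := by positivity
  generalize (2:ℝ) ^ (2 * σ) = w at *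
  have hsq : √π ^ 2 = π := Real.sq_sqrt hp.le
  have hsp : 0 < √π := Real.sqrt_pos.2 hp
  have e1 : Real.Gamma (2 * σ) = Real.Gamma σ * Real.Gamma (σ + 1 / 2) * w / (2 * √π) := by rw [d1]; field_simp
  have e2 : Real.Gamma (1 / 2 - σ) = Real.Gamma (1 - 2 * σ) * w * √π / Real.Gamma (1 - σ) := by rw [← d2]; field_simp
  rw [e1, e2]
  generalize Real.Gamma (1 - 2 * σ) = A2 at *
  generalize Real.Gamma σ = A3 at *
  generalize Real.Gamma (σ + 1 / 2) = A4 at *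
  generalize Real.Gamma (1 - σ) = A5 at *
  generalize √π = r at *
  rw [← hsq]
  field_simp

noncomputable def cc (ν : ℂ) (k : ℕ) : ℂ := ((k.factorial : ℂ)⁻¹ * (ascPochhammer ℂ k).eval (-ν) * (ascPochhammer ℂ k).eval (ν + 1) *
      ((ascPochhammer ℂ k).eval 1)⁻¹)

lemma cc_zero (ν : ℂ) : cc ν 0 = 1 := by simp [cc]

lemma cc_succ (ν : ℂ) (k : ℕ) : cc ν (k + 1) = cc ν k * ((k * (k + 1) - ν * (ν + 1)) / ((k:ℂ) + 1) ^ 2) := by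
  unfold cc
  rw [ascPochhammer_succ_eval, ascPochhammer_succ_eval, ascPochhammer_eval_one, ascPochhammer_eval_one, Nat.factorial_succ]
  have h1 : ((k:ℂ) + 1) ≠ 0 := by exact_mod_cast Nat.succ_ne_zero k
  have h2 : (k.factorial : ℂ) ≠ 0 := by exact_mod_cast k.factorial_ne_zero
  push_cast
  field_simp
  ring

lemma legendreP_eq (ν x : ℂ) : legendreP ν x = ∑' k, cc ν k * ((1 - x) / 2) ^ k := by
  unfold legendreP
  rw [ordinaryHypergeometric_eq_tsum]
  simp only [smul_eq_mul, cc]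

lemma cc_real (a : ℝ) (k : ℕ) : cc ((a:ℂ) - 1) k = (lc a k : ℂ) := by
  induction k with
  | zero => simp [cc_zero, lc_zero]
  | succ k ih =>
    have h := congrArg (fun t : ℝ => (t : ℂ)) (lc_succ a k)
    push_cast at h
    have h1 : ((k:ℂ) + 1) ≠ 0 := by exact_mod_cast Nat.succ_ne_zero k
    rw [cc_succ, ih, ← mul_div_assoc, div_eq_iff (pow_ne_zero 2 h1), h]
    ring

lemma legendreP_real (a x : ℝ) : legendreP ((a:ℂ) - 1) (x:ℂ) = (lgp a x : ℂ) := by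
  rw [legendreP_eq]
  unfold lgp lq
  rw [Complex.ofReal_tsum]
  refine tsum_congr fun k => ?_
  rw [cc_real]; push_cast; ring

lemma cc_bound (ν : ℂ) (k : ℕ) : ‖cc ν (k + 1)‖ ≤ ‖ν * (ν + 1)‖ * Real.exp (‖ν * (ν + 1)‖ * (1 - 1 / ((k:ℝ) + 1))) / ((k:ℝ) + 1) := by
  induction k with
  | zero => simp [cc_succ, cc_zero]
  | succ k ih =>
    rw [cc_succ, norm_mul]
    set l := ‖ν * (ν + 1)‖ with hl
    have hl0 : 0 ≤ l := norm_nonneg _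
    have hk : (0:ℝ) ≤ k := k.cast_nonneg
    have h1 : ‖(((k + 1 : ℕ) : ℂ) * (((k + 1 : ℕ):ℂ) + 1) - ν * (ν + 1)) / (((k + 1 : ℕ):ℂ) + 1) ^ 2‖ ≤ 
        ((k:ℝ) + 1) / (k + 2) * Real.exp (l * (1 / ((k:ℝ) + 1) - 1 / ((k:ℝ) + 2))) := by
      have e1 : ‖(((k + 1 : ℕ):ℂ) + 1) ^ 2‖ = ((k:ℝ) + 2) ^ 2 := by
        rw [norm_pow]
        have : (((k + 1 : ℕ):ℂ) + 1) = (((k:ℝ) + 2 : ℝ) : ℂ) := by push_cast; ring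
        rw [this, Complex.norm_real, Real.norm_of_nonneg (by positivity)]
      have e2 : ‖(((k + 1 : ℕ) : ℂ) * (((k + 1 : ℕ):ℂ) + 1) - ν * (ν + 1))‖ ≤ ((k:ℝ) + 1) * (k + 2) + l := by
        refine (norm_sub_le _ _).trans ?_
        have : ((k + 1 : ℕ) : ℂ) * (((k + 1 : ℕ):ℂ) + 1) = ((((k:ℝ) + 1) * (k + 2) : ℝ) : ℂ) := by push_cast; ring
        rw [this, Complex.norm_real, Real.norm_of_nonneg (by positivity)]
      rw [norm_div, e1]
      have e3 := Real.add_one_le_exp (l * (1 / ((k:ℝ) + 1) - 1 / ((k:ℝ) + 2)))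
      calc _ ≤ (((k:ℝ) + 1) * (k + 2) + l) / ((k:ℝ) + 2) ^ 2 := by gcongr
        _ = ((k:ℝ) + 1) / (k + 2) * (l * (1 / ((k:ℝ) + 1) - 1 / ((k:ℝ) + 2)) + 1) := by field_simp; ring
        _ ≤ _ := by gcongr
    calc _ ≤ (l * Real.exp (l * (1 - 1 / ((k:ℝ) + 1))) / ((k:ℝ) + 1)) * (((k:ℝ) + 1) / (k + 2) * Real.exp (l * (1 / ((k:ℝ) + 1) - 1 / ((k:ℝ) + 2)))) := by gcongr
      _ = l * (Real.exp (l * (1 - 1 / ((k:ℝ) + 1))) * Real.exp (l * (1 / ((k:ℝ) + 1) - 1 / ((k:ℝ) + 2)))) / (k + 2) := by field_simp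
      _ = _ := by
        rw [← Real.exp_add]; push_cast
        rw [show (k:ℝ) + 1 + 1 = k + 2 by ring]
        congr 3; ring

noncomputable def mb (l : ℝ) (k : ℕ) : ℝ := if k = 0 then 1 else l * Real.exp l / k

lemma cc_mb {ν : ℂ} {l : ℝ} (hl : ‖ν * (ν + 1)‖ ≤ l) (k : ℕ) : ‖cc ν k‖ ≤ mb l k := by
  cases k with
  | zero => simp [cc_zero, mb]
  | succ k =>
    refine (cc_bound ν k).trans ?_
    have hl0 := norm_nonneg (ν * (ν + 1))
    have : (0:ℝ) ≤ 1 / ((k:ℝ) + 1) := by positivity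
    simp only [mb, Nat.add_eq_zero_iff, one_ne_zero, and_false, if_false]
    push_cast
    have h2 : ‖ν * (ν + 1)‖ * (1 - 1 / ((k:ℝ) + 1)) ≤ l := by nlinarith
    have h3 : 0 ≤ l := hl0.trans hl
    gcongr

lemma mb_sum {l z : ℝ} (hz : |z| < 1) : HasSum (fun k => mb l k * z ^ k) (1 + l * Real.exp l * (-Real.log (1 - z))) := by
  have h := (Real.hasSum_pow_div_log_of_abs_lt_one hz).mul_left (l * Real.exp l)
  have h2 := (hasSum_nat_add_iff' (f := fun k => mb l k * z ^ k) (g := 1 + l * Real.exp l * (-Real.log (1 - z))) 1).1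
  apply h2
  have e : (fun k => mb l (k + 1) * z ^ (k + 1)) = fun k : ℕ => l * Real.exp l * (z ^ (k + 1) / (k + 1)) := by
    ext k; simp [mb]; ring
  rw [e]
  simpa [mb] using h

lemma legendreP_bound {ν : ℂ} {l ε x : ℝ} (hl : ‖ν * (ν + 1)‖ ≤ l) (hε : 0 < ε) (hx0 : -1 < x) (hx1 : x < 1) :
    ‖legendreP ν x‖ ≤ (1 + l * Real.exp l / ε) * ((1 + x) / 2) ^ (-ε) := by
  have hl0 : 0 ≤ l := (norm_nonneg _).trans hl
  set z := (1 - x) / 2 with hz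
  have hz0 : 0 < z := by rw [hz]; linarith
  have hz1 : z < 1 := by rw [hz]; linarith
  have hzz : |z| < 1 := by rw [abs_of_pos hz0]; exact hz1
  rw [legendreP_eq, show (1 - (x:ℂ)) / 2 = (z : ℂ) by rw [hz]; push_cast; ring]
  have hs := mb_sum (l := l) hzz
  refine (tsum_of_norm_bounded hs fun k => ?_).trans ?_
  · rw [norm_mul, norm_pow, Complex.norm_real, Real.norm_of_nonneg hz0.le]
    gcongr; exact cc_mb hl k
  · rw [show 1 - z = (1 + x) / 2 by rw [hz]; ring]
    have hu : 0 < (1 + x) / 2 := by linarith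
    have hu1 : (1 + x) / 2 < 1 := by linarith
    generalize (1 + x) / 2 = u at *
    have h1 : -Real.log u ≤ u ^ (-ε) / ε := by
      have := Real.log_le_rpow_div (x := u⁻¹) (by positivity) hε
      rwa [Real.log_inv, Real.inv_rpow hu.le, ← Real.rpow_neg hu.le] at this
    have h2 : 1 ≤ u ^ (-ε) := Real.one_le_rpow_of_pos_of_le_one_of_nonpos hu hu1.le (by linarith)
    have h3 : l * Real.exp l * (-Real.log u) ≤ l * Real.exp l * (u ^ (-ε) / ε) := by gcongr
    calc _ ≤ u ^ (-ε) + l * Real.exp l * (u ^ (-ε) / ε) := by linarith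
      _ = _ := by ring

lemma cc_diff (k : ℕ) : Differentiable ℂ (fun ν => cc ν k) := by
  induction k with
  | zero => simp [cc_zero]
  | succ k ih =>
    simp only [cc_succ]
    fun_prop

lemma legendreP_diff {x : ℝ} (hx0 : -1 < x) (hx1 : x < 1) : Differentiable ℂ (fun ν => legendreP ν x) := by
  intro ν₀
  have hz0 : 0 < (1 - x) / 2 := by linarith
  obtain ⟨l, hl⟩ := (isCompact_closedBall ν₀ 1).exists_bound_of_continuousOn (f := fun ν : ℂ => ν * (ν + 1)) (by fun_prop)
  have hs := (mb_sum (l := l) (z := (1 - x) / 2) (by rw [abs_of_pos hz0]; linarith)).summable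
  have : DifferentiableOn ℂ (fun ν => ∑' k, cc ν k * ((1 - (x:ℂ)) / 2) ^ k) (Metric.ball ν₀ 1) := by
    refine differentiableOn_tsum_of_summable_norm hs (fun k => ((cc_diff k).mul_const _).differentiableOn) Metric.isOpen_ball fun k ν hν => ?_
    rw [norm_mul, norm_pow, show (1 - (x:ℂ)) / 2 = (((1 - x) / 2 : ℝ) : ℂ) by push_cast; ring, Complex.norm_real, Real.norm_of_nonneg hz0.le]
    gcongr; exact cc_mb (hl ν (Metric.ball_subset_closedBall hν)) k
  simp only [legendreP_eq]
  exact this.differentiableAt (Metric.ball_mem_nhds _ one_pos)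

lemma legendreP_meas (ν : ℂ) : Measurable (fun x : ℝ => legendreP ν x) := by
  simp only [legendreP_eq]
  refine Measurable.tsum (fun k => ?_)
  fun_prop

lemma holo_int {μ : Measure ℝ} (F : ℂ → ℝ → ℂ) (ν₀ : ℂ) {R : ℝ} (hR : 0 < R) (bound : ℝ → ℝ) (hb : Integrable bound μ)
    (hm : ∀ ν, AEStronglyMeasurable (F ν) μ) (hd : ∀ᵐ x ∂μ, Differentiable ℂ (fun ν => F ν x))
    (h : ∀ᵐ x ∂μ, ∀ ν ∈ Metric.ball ν₀ R, ‖F ν x‖ ≤ bound x) : DifferentiableAt ℂ (fun ν => ∫ x, F ν x ∂μ) ν₀ := by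
  have hmeas : AEStronglyMeasurable (fun x => deriv (fun ν => F ν x) ν₀) μ := by
    have hseq : Filter.Tendsto (fun n : ℕ => (1 / ((n:ℂ) + 1))) Filter.atTop (nhdsWithin 0 {0}ᶜ) := by
      rw [tendsto_nhdsWithin_iff]
      refine ⟨tendsto_one_div_add_atTop_nhds_zero_nat, Filter.Eventually.of_forall fun n => ?_⟩
      have : ((n:ℂ) + 1) ≠ 0 := by exact_mod_cast Nat.succ_ne_zero n
      simpa using this
    refine aestronglyMeasurable_of_tendsto_ae (f := fun n : ℕ => fun x => (1 / ((n:ℂ) + 1))⁻¹ • (F (ν₀ + (1 / ((n:ℂ) + 1))) x - F ν₀ x)) Filter.atTop (fun n => ?_) ?_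
    · exact ((hm _).sub (hm _)).const_smul ((1 / ((n:ℂ) + 1))⁻¹)
    · filter_upwards [hd] with x hx
      exact (hx ν₀).hasDerivAt.tendsto_slope_zero.comp hseq
  refine (hasDerivAt_integral_of_dominated_loc_of_deriv_le (s := Metric.ball ν₀ (R / 2)) (F' := fun ν x => deriv (fun ν => F ν x) ν) (bound := fun x => bound x / (R / 4))
    (Metric.ball_mem_nhds _ (by linarith)) (Filter.Eventually.of_forall hm) ?_ hmeas ?_ (hb.div_const _) ?_).2.differentiableAt
  · refine hb.mono' (hm ν₀) ?_
    filter_upwards [h] with x hx using hx ν₀ (Metric.mem_ball_self hR)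
  · filter_upwards [h, hd] with x hx hdx ν hν
    refine Complex.norm_deriv_le_of_forall_mem_sphere_norm_le (by linarith) hdx.diffContOnCl fun w hw => hx w ?_
    rw [Metric.mem_ball] at hν ⊢
    rw [Metric.mem_sphere] at hw
    linarith [dist_triangle w ν ν₀]
  · filter_upwards [hd] with x hx ν _ using (hx ν).hasDerivAt

lemma w_int {s : ℝ} (hs : -1 < s) : IntegrableOn (fun x : ℝ => (1 - x ^ 2) ^ s) (Ioo (-1) 1) := by
  refine ⟨by apply Measurable.aestronglyMeasurable; fun_prop, ?_⟩
  rw [hasFiniteIntegral_iff_norm]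
  have e : ∀ x ∈ Ioo (-1:ℝ) 1, ENNReal.ofReal ‖(1 - x ^ 2) ^ s‖ = ENNReal.ofReal ((1 - x ^ 2) ^ s) := by
    intro x hx
    rw [Real.norm_of_nonneg]
    exact Real.rpow_nonneg (by nlinarith [hx.1, hx.2]) _
  rw [setLIntegral_congr_fun measurableSet_Ioo e, fold_even _ (by fun_prop), x_to_t]
  have e2 : ∀ t ∈ Ioo (0:ℝ) 1, ENNReal.ofReal (1 / 2 * (1 - t) ^ (-1/2:ℝ)) * (ENNReal.ofReal ((1 - √(1 - t) ^ 2) ^ s) + ENNReal.ofReal ((1 - (-√(1 - t)) ^ 2) ^ s))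
      = ENNReal.ofReal (t ^ ((s + 1) - 1) * (1 - t) ^ ((1/2:ℝ) - 1)) := by
    intro t ht
    have h1 : 0 < 1 - t := by linarith [ht.2]
    have h0 := ht.1
    rw [neg_sq, Real.sq_sqrt h1.le, show 1 - (1 - t) = t by ring, ← ENNReal.ofReal_add (by positivity) (by positivity), ← ENNReal.ofReal_mul (by positivity)]
    congr 1
    rw [show s + 1 - 1 = s by ring, show (1/2:ℝ) - 1 = -1/2 by norm_num]; ring
  rw [setLIntegral_congr_fun measurableSet_Ioo e2, li_beta (by linarith) (by norm_num)]
  exact ENNReal.ofReal_lt_top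

noncomputable def GG (ν : ℂ) (x : ℝ) : ℂ := (legendreP ν (x : ℂ)) ^ 2 * legendreP ν (-(x : ℂ)) * ((1 - (x:ℂ) ^ 2) ^ ((ν - 1)/2))

lemma GG_holo {ν₀ : ℂ} (h : -1 < ν₀.re) : DifferentiableAt ℂ (fun ν => ∫ x in Ioo (-1:ℝ) 1, GG ν x) ν₀ := by
  set R := (ν₀.re + 1) / 2 with hR
  have hR0 : 0 < R := by rw [hR]; linarith
  obtain ⟨l, hl⟩ := (isCompact_closedBall ν₀ R).exists_bound_of_continuousOn (f := fun ν : ℂ => ν * (ν + 1)) (by fun_prop)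
  have hl0 : 0 ≤ l := (norm_nonneg _).trans (hl ν₀ (Metric.mem_closedBall_self hR0.le))
  set ε := R / 8 with hε
  have hε0 : 0 < ε := by rw [hε]; linarith
  set s := (R - 2) / 2 - 2 * ε with hs
  have hs1 : -1 < s := by rw [hs, hε]; linarith
  set K := (1 + l * Real.exp l / ε) with hK
  have hK0 : 0 ≤ K := by rw [hK]; positivity
  refine holo_int GG ν₀ hR0 (fun x => K ^ 3 * (1 / 4 : ℝ) ^ (-(2 * ε)) * (1 - x ^ 2) ^ s) ((w_int hs1).const_mul _) ?_ ?_ ?_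
  · intro ν
    apply Measurable.aestronglyMeasurable
    have h1 := legendreP_meas ν
    have h2 : Measurable (fun x : ℝ => legendreP ν (-(x:ℂ))) := by
      have := h1.comp measurable_neg
      simpa [Function.comp_def] using this
    unfold GG
    fun_prop
  · filter_upwards [self_mem_ae_restrict measurableSet_Ioo] with x hx
    have d1 := legendreP_diff hx.1 hx.2
    have d2 := legendreP_diff (x := -x) (by linarith [hx.2]) (by linarith [hx.1])
    push_cast at d2
    have hne : (1 - (x:ℂ) ^ 2) ≠ 0 := by
      have : 1 - x ^ 2 ≠ 0 := by nlinarith [hx.1, hx.2]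
      exact_mod_cast this
    unfold GG
    refine ((d1.pow 2).mul d2).mul ?_
    intro ν
    exact DifferentiableAt.const_cpow (by fun_prop) (Or.inl hne)
  · filter_upwards [self_mem_ae_restrict measurableSet_Ioo] with x hx ν hν
    obtain ⟨hx0, hx1⟩ := hx
    have hlν := hl ν (Metric.ball_subset_closedBall hν)
    have b1 := legendreP_bound hlν hε0 hx0 hx1
    have b2 := legendreP_bound (x := -x) hlν hε0 (by linarith) (by linarith)
    push_cast at b2
    have hw : 0 < 1 - x ^ 2 := by nlinarith
    have hw1 : 1 - x ^ 2 ≤ 1 := by nlinarith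
    have hre : R - 1 ≤ ν.re := by
      have h1 := Complex.abs_re_le_norm (ν - ν₀)
      rw [Metric.mem_ball, dist_eq_norm] at hν
      have h2 := (abs_le.1 h1).1
      rw [Complex.sub_re] at h2
      linarith
    have b3 : ‖(1 - (x:ℂ) ^ 2) ^ ((ν - 1)/2)‖ ≤ (1 - x ^ 2) ^ ((R - 2) / 2) := by
      rw [show (1 - (x:ℂ) ^ 2) = ((1 - x ^ 2 : ℝ) : ℂ) by push_cast; ring, Complex.norm_cpow_eq_rpow_re_of_pos hw]
      refine Real.rpow_le_rpow_of_exponent_ge hw hw1 ?_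
      have : ((ν - 1) / 2).re = (ν.re - 1) / 2 := by simp
      rw [this]; linarith
    have hu : 0 < (1 + x) / 2 := by linarith
    have hv : 0 < (1 + -x) / 2 := by linarith
    have hv1 : (1 + -x) / 2 ≤ 1 := by linarith
    unfold GG
    rw [norm_mul, norm_mul, norm_pow]
    change _ ≤ K * _ at b1
    change _ ≤ K * _ at b2
    calc _ ≤ (K * ((1 + x) / 2) ^ (-ε)) ^ 2 * (K * ((1 + -x) / 2) ^ (-ε)) * (1 - x ^ 2) ^ ((R - 2) / 2) := by gcongr
      _ ≤ (K * ((1 + x) / 2) ^ (-ε)) ^ 2 * (K * ((1 + -x) / 2) ^ (-(2 * ε))) * (1 - x ^ 2) ^ ((R - 2) / 2) := by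
        have : ((1 + -x) / 2) ^ (-ε) ≤ ((1 + -x) / 2) ^ (-(2 * ε)) := Real.rpow_le_rpow_of_exponent_ge hv hv1 (by linarith)
        gcongr
      _ = K ^ 3 * ((((1 + x) / 2) ^ (-ε)) ^ 2 * ((1 + -x) / 2) ^ (-(2 * ε))) * (1 - x ^ 2) ^ ((R - 2) / 2) := by ring
      _ = _ := by
        have e1 : (((1 + x) / 2) ^ (-ε)) ^ 2 = ((1 + x) / 2) ^ (-(2 * ε)) := by
          rw [← Real.rpow_natCast, ← Real.rpow_mul hu.le]; congr 1; push_cast; ring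
        rw [e1, ← Real.mul_rpow hu.le hv.le, show (1 + x) / 2 * ((1 + -x) / 2) = 1 / 4 * (1 - x ^ 2) by ring, Real.mul_rpow (by norm_num) hw.le,
          hs, sub_eq_add_neg ((R - 2) / 2), Real.rpow_add hw]
        ring

noncomputable def RR (ν : ℂ) : ℂ := (1 / π) * (Complex.cos (ν * π / 2) / 2 ^ ν) ^ 3 *
        (Complex.Gamma ((1 + ν)/2) / Complex.Gamma (1 + ν/2)) ^ 4

lemma RR_holo {ν₀ : ℂ} (h : -1 < ν₀.re) : DifferentiableAt ℂ RR ν₀ := by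
  unfold RR
  have g : DifferentiableAt ℂ (fun ν => Complex.Gamma ((1 + ν)/2)) ν₀ := by
    have := Complex.differentiableAt_Gamma ((1 + ν₀)/2) (fun m hm => by
      have h1 := congrArg Complex.re hm
      simp at h1
      have : (0:ℝ) ≤ m := m.cast_nonneg
      linarith)
    exact DifferentiableAt.comp (f := fun ν : ℂ => (1 + ν)/2) ν₀ this (by fun_prop)
  have g2 : DifferentiableAt ℂ (fun ν => (Complex.Gamma (1 + ν/2))⁻¹) ν₀ :=
    DifferentiableAt.comp (g := fun s => (Complex.Gamma s)⁻¹) (f := fun ν : ℂ => 1 + ν/2) ν₀ (Complex.differentiable_one_div_Gamma _) (by fun_prop)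
  have g3 : DifferentiableAt ℂ (fun ν => Complex.cos (ν * π / 2) / 2 ^ ν) ν₀ := by
    refine DifferentiableAt.div (by fun_prop) (DifferentiableAt.const_cpow (by fun_prop) (Or.inl two_ne_zero)) ?_
    simp [Complex.cpow_eq_zero_iff]
  simp only [div_eq_mul_inv (Complex.Gamma _)]
  exact ((g3.pow 3).const_mul _).mul ((g.mul g2).pow 4)

lemma real_case {σ : ℝ} (h0 : 0 < σ) (h1 : σ < 1 / 4) : ∫ x in Ioo (-1:ℝ) 1, GG ((2 * σ - 1 : ℝ) : ℂ) x = RR ((2 * σ - 1 : ℝ) : ℂ) := by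
  set f : ℝ → ℝ := fun x => lgp (2 * σ) x ^ 2 * lgp (2 * σ) (-x) * (1 - x ^ 2) ^ (σ - 1) with hf
  have e : ∀ x ∈ Ioo (-1:ℝ) 1, GG ((2 * σ - 1 : ℝ) : ℂ) x = ((f x : ℝ) : ℂ) := by
    intro x hx
    have hw : 0 < 1 - x ^ 2 := by nlinarith [hx.1, hx.2]
    unfold GG
    have l1 := legendreP_real (2 * σ) x
    have l2 := legendreP_real (2 * σ) (-x)
    rw [show ((2 * σ - 1 : ℝ) : ℂ) = ((2 * σ : ℝ) : ℂ) - 1 by push_cast; ring, l1]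
    push_cast at l2 ⊢
    rw [l2, hf]
    push_cast
    congr 1
    rw [Complex.ofReal_cpow hw.le]
    push_cast
    congr 1
    ring
  rw [setIntegral_congr_fun measurableSet_Ioo e, integral_complex_ofReal]
  have hm := lgp_meas (2 * σ)
  have J := J_final h0 h1
  rw [integral_eq_lintegral_of_nonneg_ae]
  rotate_left
  · filter_upwards [self_mem_ae_restrict measurableSet_Ioo] with x hx
    obtain ⟨hx0, hx1⟩ := hx
    have hw : 0 < 1 - x ^ 2 := by nlinarith
    have q1 := lgp_pos (a := 2 * σ) (by linarith) (by linarith) hx0 hx1.le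
    have q2 := lgp_pos (a := 2 * σ) (by linarith) (by linarith) (show -1 < -x by linarith) (by linarith)
    simp only [hf, Pi.zero_apply]
    positivity
  · apply Measurable.aestronglyMeasurable
    simp only [hf]; fun_prop
  rw [J, ENNReal.toReal_ofReal]
  swap
  · have hs : 0 < Real.sin (π * σ) := Real.sin_pos_of_pos_of_lt_pi (by positivity) (by nlinarith [pi_pos])
    have g3 := Real.Gamma_pos_of_pos h0
    have g4 := Real.Gamma_pos_of_pos (show 0 < σ + 1 / 2 by linarith)
    positivity
  unfold RR
  have c1 : Complex.cos (((2 * σ - 1 : ℝ) : ℂ) * π / 2) = (Real.sin (π * σ) : ℂ) := by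
    rw [← Real.cos_pi_div_two_sub, ← Real.cos_neg]
    push_cast; congr 1; ring
  have c2 : (2:ℂ) ^ ((2 * σ - 1 : ℝ) : ℂ) = (((2:ℝ) ^ (2 * σ - 1) : ℝ) : ℂ) := by
    rw [Complex.ofReal_cpow two_pos.le]; norm_num
  have c3 : Complex.Gamma ((1 + ((2 * σ - 1 : ℝ) : ℂ))/2) = (Real.Gamma σ : ℂ) := by
    rw [← Complex.Gamma_ofReal]; congr 1; push_cast; ring
  have c4 : Complex.Gamma (1 + ((2 * σ - 1 : ℝ) : ℂ)/2) = (Real.Gamma (σ + 1 / 2) : ℂ) := by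
    rw [← Complex.Gamma_ofReal]; congr 1; push_cast; ring
  rw [c1, c2, c3, c4]
  push_cast
  rfl

theorem stmt6 (ν : ℂ) (hν : -1 < ν.re) :
    (∫ x in (-1:ℝ)..1, (legendreP ν (x : ℂ)) ^ 2 * legendreP ν (-(x : ℂ)) *
        ((1 - (x:ℂ) ^ 2) ^ ((ν - 1)/2)))
      = (1 / π) * (Complex.cos (ν * π / 2) / 2 ^ ν) ^ 3 *
        (Complex.Gamma ((1 + ν)/2) / Complex.Gamma (1 + ν/2)) ^ 4 := by
  rw [intervalIntegral.integral_of_le (by norm_num), integral_Ioc_eq_integral_Ioo]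
  change (∫ x in Ioo (-1:ℝ) 1, GG ν x) = RR ν
  set U : Set ℂ := {ν | -1 < ν.re} with hU
  have oU : IsOpen U := isOpen_lt continuous_const Complex.continuous_re
  have cU : IsPreconnected U := (convex_halfSpace_re_gt (-1)).isPreconnected
  have a1 : AnalyticOnNhd ℂ (fun ν => ∫ x in Ioo (-1:ℝ) 1, GG ν x) U :=
    DifferentiableOn.analyticOnNhd (fun ν hν => (GG_holo hν).differentiableWithinAt) oU
  have a2 : AnalyticOnNhd ℂ RR U :=
    DifferentiableOn.analyticOnNhd (fun ν hν => (RR_holo hν).differentiableWithinAt) oU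
  have hz : ((-3/4 : ℝ) : ℂ) ∈ U := by
    show -1 < (((-3/4 : ℝ) : ℂ)).re
    rw [Complex.ofReal_re]; norm_num
  refine a1.eqOn_of_preconnected_of_frequently_eq a2 cU hz ?_ hν
  have hseq : Filter.Tendsto (fun n : ℕ => ((-3/4 + 1 / ((n:ℝ) + 1) * (1 / 8) : ℝ) : ℂ)) Filter.atTop (nhdsWithin ((-3/4 : ℝ) : ℂ) {((-3/4 : ℝ) : ℂ)}ᶜ) := by
    rw [tendsto_nhdsWithin_iff]
    constructor
    · have t := (tendsto_one_div_add_atTop_nhds_zero_nat (𝕜 := ℝ)).mul_const (1 / 8 : ℝ)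
      have t2 := t.const_add (-3/4 : ℝ)
      rw [zero_mul, add_zero] at t2
      exact (Complex.continuous_ofReal.tendsto _).comp t2
    · refine Filter.Eventually.of_forall fun n => ?_
      have : (0:ℝ) < 1 / ((n:ℝ) + 1) * (1 / 8) := by positivity
      intro hc
      have hc' := Complex.ofReal_injective hc
      linarith
  refine hseq.frequently (Filter.Eventually.frequently (Filter.Eventually.of_forall fun n => ?_))
  have p1 : (0:ℝ) < 1 / ((n:ℝ) + 1) := by positivity
  have p2 : 1 / ((n:ℝ) + 1) ≤ 1 := by
    rw [div_le_one (by positivity)]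
    have : (0:ℝ) ≤ n := n.cast_nonneg
    linarith
  have := real_case (σ := (1/4 + 1 / ((n:ℝ) + 1) * (1 / 8)) / 2) (by linarith) (by linarith)
  rw [show 2 * ((1/4 + 1 / ((n:ℝ) + 1) * (1 / 8)) / 2) - 1 = -3/4 + 1 / ((n:ℝ) + 1) * (1 / 8) by ring] at this
  exact this
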